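/- arXiv:1905.04103 — 3 statements merged into one kernel-verified Lean document; each statement's English description precedes it below -/
import Mathlib

section
/- Under hypotheses (i)–(iv) on the process v, for every p ≥ 2 there exists a constant c depending only on p, C and τ such that for every T ≥ 0, E[ ‖ ∫_0^T v_t dt ‖^p ] ≤ c · T^{p/2}. -/
open MeasureTheory

set_option linter.unusedSectionVars false

section helpers
variable {H : Type*} [NormedAddCommGroup H] [InnerProductSpace ℝ H] [CompleteSpace H]

lemma aux_ii {u : ℝ → H} (hu : StronglyMeasurable u) (hb : ∀ t, ‖u t‖ ≤ 1) (a b : ℝ) :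
    IntervalIntegrable u volume a b := by
  refine (intervalIntegrable_const (c := (1:ℝ))).mono_fun hu.aestronglyMeasurable ?_
  filter_upwards with t
  simpa using hb t

lemma aux_lip {u : ℝ → H} (hu : StronglyMeasurable u) (hb : ∀ t, ‖u t‖ ≤ 1) :
    LipschitzWith 1 (fun t => ∫ r in (0:ℝ)..t, u r) := by
  refine LipschitzWith.of_dist_le_mul fun x y => ?_
  rw [dist_eq_norm, intervalIntegral.integral_interval_sub_left (aux_ii hu hb _ _) (aux_ii hu hb _ _)]
  have := intervalIntegral.norm_integral_le_of_norm_le_const (a := y) (b := x) (C := 1)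
    (f := u) (fun t _ => hb t)
  simpa [Real.dist_eq] using this

lemma aux_bd {u : ℝ → H} (hb : ∀ t, ‖u t‖ ≤ 1) (t : ℝ) :
    ‖∫ r in (0:ℝ)..t, u r‖ ≤ |t| := by
  have := intervalIntegral.norm_integral_le_of_norm_le_const (a := 0) (b := t) (C := 1)
    (f := u) (fun t _ => hb t)
  simpa using this

lemma aux_deriv {u : ℝ → H} (hu : StronglyMeasurable u) (hb : ∀ t, ‖u t‖ ≤ 1) :
    ∀ᵐ t, HasDerivAt (fun t => ∫ r in (0:ℝ)..t, u r) (u t) t := by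
  have : LocallyIntegrable u volume := by
    refine (locallyIntegrable_const (1:ℝ)).mono hu.aestronglyMeasurable ?_
    filter_upwards with t
    simpa using hb t
  filter_upwards [LocallyIntegrable.ae_hasDerivAt_integral this] with t ht using ht 0

lemma aux_ac_norm {S : ℝ → H} (hS : LipschitzWith 1 S) (a b : ℝ) (k : ℕ) :
    AbsolutelyContinuousOnInterval (fun t => (‖S t‖ ^ 2) ^ k) a b := by
  have h1 : AbsolutelyContinuousOnInterval (fun t => ‖S t‖) a b := by
    have : LipschitzWith 1 (fun t => ‖S t‖) := by
      simpa using! lipschitzWith_one_norm.comp hS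
    exact (this.lipschitzOnWith).absolutelyContinuousOnInterval
  have h2 : AbsolutelyContinuousOnInterval (fun t => ‖S t‖ ^ 2) a b := by
    simpa [pow_two] using! h1.mul h1
  induction k with
  | zero =>
    simp only [pow_zero]
    exact ((LipschitzWith.const (1:ℝ)).lipschitzOnWith).absolutelyContinuousOnInterval
  | succ k ih =>
    simpa [pow_succ] using! ih.mul h2

lemma aux_ac_inner {S : ℝ → H} (hS : LipschitzWith 1 S) (h : H) (a b : ℝ) :
    AbsolutelyContinuousOnInterval (fun t => inner ℝ (S t) h) a b := by
  have : LipschitzWith (‖innerSL ℝ h‖₊ * 1) (fun t => inner ℝ (S t) h) := by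
    have := (innerSL ℝ h).lipschitz.comp hS
    have e : (fun t => inner ℝ (S t) h) = (⇑(innerSL ℝ h) ∘ S) := by
      funext t; simp [real_inner_comm]
    rw [e]; exact this
  exact (this.lipschitzOnWith).absolutelyContinuousOnInterval

lemma aux_ftc {f f' : ℝ → ℝ} {a b : ℝ} (hf : AbsolutelyContinuousOnInterval f a b)
    (hd : ∀ᵐ t, HasDerivAt f (f' t) t) : f b - f a = ∫ t in a..b, f' t := by
  rw [← hf.integral_deriv_eq_sub]
  refine intervalIntegral.integral_congr_ae ?_
  filter_upwards [hd] with t ht _ using ht.deriv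

lemma aux_path1 {u : ℝ → H} (hu : StronglyMeasurable u) (hb : ∀ t, ‖u t‖ ≤ 1) (T : ℝ) (k : ℕ) :
    (‖∫ r in (0:ℝ)..T, u r‖ ^ 2) ^ (k + 1) =
      ∫ t in (0:ℝ)..T, (2 * (k + 1)) * ((‖∫ r in (0:ℝ)..t, u r‖ ^ 2) ^ k *
        inner ℝ (∫ r in (0:ℝ)..t, u r) (u t)) := by
  rw [← aux_ftc (aux_ac_norm (aux_lip hu hb) 0 T (k + 1))]
  · simp
  · filter_upwards [aux_deriv hu hb] with t ht
    have := (ht.norm_sq).pow (k + 1)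
    convert! this using 1
    push_cast
    ring

/-- the derivative of `G(S) = ‖S‖^(2k) S` in direction `u`. -/
noncomputable def auxW (k : ℕ) (S u : H) : H :=
  (k * (‖S‖ ^ 2) ^ (k - 1) * (2 * inner ℝ S u)) • S + ((‖S‖ ^ 2) ^ k) • u

lemma auxW_cont (k : ℕ) : Continuous (fun x : H × H => auxW k x.1 x.2) := by
  unfold auxW; fun_prop

lemma auxW_bd (k : ℕ) (S u : H) (hu : ‖u‖ ≤ 1) :
    ‖auxW k S u‖ ≤ (2 * k + 1) * (‖S‖ ^ 2) ^ k := by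
  unfold auxW
  have h1 : |inner ℝ S u| ≤ ‖S‖ := by
    refine (abs_real_inner_le_norm S u).trans ?_
    nlinarith [norm_nonneg S]
  have h2 : ‖(k * (‖S‖ ^ 2) ^ (k - 1) * (2 * inner ℝ S u)) • S‖ ≤ 2 * k * (‖S‖ ^ 2) ^ k := by
    rw [norm_smul, norm_mul, norm_mul, norm_mul]
    simp only [Real.norm_eq_abs, Nat.abs_cast, abs_pow, abs_norm, Nat.abs_ofNat]
    calc _ ≤ k * (‖S‖ ^ 2) ^ (k - 1) * (2 * ‖S‖) * ‖S‖ := by gcongr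
      _ = 2 * (k * ((‖S‖ ^ 2) ^ (k - 1) * ‖S‖ ^ 2)) := by ring
      _ = _ := by
        rcases k with _ | k
        · simp
        · simp [pow_succ]; ring
  have h3 : ‖((‖S‖ ^ 2) ^ k) • u‖ ≤ (‖S‖ ^ 2) ^ k := by
    rw [norm_smul, Real.norm_of_nonneg (by positivity)]
    exact mul_le_of_le_one_right (by positivity) hu
  refine (norm_add_le _ _).trans ?_
  linarith

lemma aux_path2 {u : ℝ → H} (hu : StronglyMeasurable u) (hb : ∀ t, ‖u t‖ ≤ 1) (T : ℝ) (k : ℕ)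
    (h : H) :
    (‖∫ r in (0:ℝ)..T, u r‖ ^ 2) ^ k * inner ℝ (∫ r in (0:ℝ)..T, u r) h =
      ∫ t in (0:ℝ)..T, inner ℝ (auxW k (∫ r in (0:ℝ)..t, u r) (u t)) h := by
  rw [← aux_ftc ((aux_ac_norm (aux_lip hu hb) 0 T k).mul (aux_ac_inner (aux_lip hu hb) h 0 T))]
  · simp
  · filter_upwards [aux_deriv hu hb] with t ht
    have := ((ht.norm_sq).pow k).mul (ht.inner ℝ (hasDerivAt_const t h))
    convert! this using 1
    simp [auxW, inner_add_left, inner_smul_left]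

lemma aux_exp (τ : ℝ) (hτ : 0 < τ) (t : ℝ) :
    ∫ s in (0:ℝ)..t, Real.exp (-(t - s) / τ) ≤ τ := by
  have : ∀ s ∈ Set.uIcc 0 t, HasDerivAt (fun s => τ * Real.exp (-(t - s) / τ))
      (Real.exp (-(t - s) / τ)) s := by
    intro s _
    have := ((((hasDerivAt_id s).const_sub t).neg.div_const τ).exp).const_mul τ
    convert! this using 1
    simp
    field_simp
  rw [intervalIntegral.integral_eq_sub_of_hasDerivAt this
    (Continuous.intervalIntegrable (by fun_prop) _ _)]
  simp
  positivity

end helpers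

section prob
variable {H : Type*} [NormedAddCommGroup H] [InnerProductSpace ℝ H] [CompleteSpace H]
  {Ω : Type*} {mΩ : MeasurableSpace Ω} {P : Measure Ω} [IsProbabilityMeasure P]

lemma aux_integrable {E : Type*} [NormedAddCommGroup E] {f : ℝ × Ω → E}
    (hf : StronglyMeasurable f) (a b K : ℝ)
    (hK : ∀ s ∈ Set.uIoc a b, ∀ ω, ‖f (s, ω)‖ ≤ K) :
    Integrable f ((volume.restrict (Set.uIoc a b)).prod P) := by
  have : IsFiniteMeasure ((volume : Measure ℝ).restrict (Set.uIoc a b)) := by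
    rw [Set.uIoc]; infer_instance
  refine Integrable.of_bound hf.aestronglyMeasurable K ?_
  have : (volume.restrict (Set.uIoc a b)).prod P
      = ((volume : Measure ℝ).prod P).restrict (Set.uIoc a b ×ˢ Set.univ) := by
    rw [← Measure.prod_restrict, Measure.restrict_univ]
  rw [this]
  refine ae_restrict_of_forall_mem (measurableSet_uIoc.prod MeasurableSet.univ) ?_
  rintro ⟨s, ω⟩ h
  exact hK s h.1 ω

lemma aux_S_meas {w : ℝ → Ω → H} (hw : StronglyMeasurable (Function.uncurry w))
    (hb : ∀ t ω, ‖w t ω‖ ≤ 1) :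
    StronglyMeasurable (Function.uncurry (fun t ω => ∫ r in (0:ℝ)..t, w r ω)) := by
  refine stronglyMeasurable_uncurry_of_continuous_of_stronglyMeasurable ?_ ?_
  · intro ω
    exact (aux_lip (u := fun r => w r ω)
      (hw.comp_measurable measurable_prodMk_right) (fun t => hb t ω)).continuous
  · intro t
    have h2 : StronglyMeasurable (fun q : Ω × ℝ => w q.2 q.1) :=
      hw.comp_measurable measurable_swap
    simp only [intervalIntegral]
    exact (h2.integral_prod_right (ν := volume.restrict (Set.Ioc 0 t))).sub
      (h2.integral_prod_right (ν := volume.restrict (Set.Ioc t 0)))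

lemma aux_S_adapted {F : ℝ → MeasurableSpace Ω} {w : ℝ → Ω → H} (hF : Monotone F)
    (hFm : ∀ t, F t ≤ mΩ) (hw : StronglyMeasurable (Function.uncurry w))
    (hb : ∀ t ω, ‖w t ω‖ ≤ 1) (had : ∀ t, StronglyMeasurable[F t] (w t)) (s : ℝ) (hs : 0 ≤ s) :
    AEStronglyMeasurable[F s] (fun ω => ∫ r in (0:ℝ)..s, w r ω) P := by
  set X : Ω → H := fun ω => ∫ r in (0:ℝ)..s, w r ω with hX
  have hXm : StronglyMeasurable X := (aux_S_meas hw hb).comp_measurable measurable_prodMk_left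
  have hXb : ∀ ω, ‖X ω‖ ≤ |s| := fun ω => aux_bd (u := fun r => w r ω) (fun t => hb t ω) s
  have hXi : Integrable X P := Integrable.of_bound hXm.aestronglyMeasurable _ (ae_of_all _ hXb)
  have hwi : ∀ r, Integrable (w r) P := fun r =>
    Integrable.of_bound ((had r).mono (hFm r)).aestronglyMeasurable 1 (ae_of_all _ (hb r))
  have key : X =ᵐ[P] P[X | F s] := by
    refine Integrable.ae_eq_of_forall_setIntegral_eq _ _ hXi integrable_condExp ?_
    intro A hA _
    set Z : Ω → ℝ := A.indicator (fun _ => 1) with hZ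
    have hZm : StronglyMeasurable Z := stronglyMeasurable_const.indicator hA
    have hZb : ∀ ω, ‖Z ω‖ ≤ 1 := by
      intro ω; by_cases h : ω ∈ A <;> simp [hZ, h]
    have hZi : Integrable Z P := Integrable.of_bound hZm.aestronglyMeasurable _ (ae_of_all _ hZb)
    have hZY : ∀ Y : Ω → H, ∫ ω in A, Y ω ∂P = ∫ ω, Z ω • Y ω ∂P := by
      intro Y
      rw [← integral_indicator hA]
      congr 1; ext ω
      by_cases h : ω ∈ A <;> simp [hZ, h]
    set Z' : Ω → ℝ := P[Z | F s] with hZ'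
    have hZ'm : StronglyMeasurable[F s] Z' := stronglyMeasurable_condExp
    have hZ'b : ∀ᵐ ω ∂P, ‖Z' ω‖ ≤ 1 := by
      have := ae_bdd_abs_condExp_of_ae_bdd_abs (m := F s) (R := (1:ℝ)) (μ := P) (f := Z) (by
        filter_upwards with ω using hZb ω)
      simpa using this
    -- pull-out
    have pull : ∀ Y : Ω → H, StronglyMeasurable[F s] Y → Integrable Y P →
        ∫ ω, Z ω • Y ω ∂P = ∫ ω, Z' ω • Y ω ∂P := by
      intro Y hY hYi
      have hi : Integrable (Z • Y) P := hYi.bdd_smul 1 hZm.aestronglyMeasurable (ae_of_all _ hZb)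
      have := condExp_smul_of_aestronglyMeasurable_right (m := F s) hZi hi
        hY.aestronglyMeasurable
      rw [← integral_condExp (hFm s)]
      exact integral_congr_ae this
    have pull2 : ∫ ω, Z ω • (P[X | F s]) ω ∂P = ∫ ω, Z' ω • X ω ∂P := by
      rw [pull _ stronglyMeasurable_condExp integrable_condExp]
      have hi : Integrable (Z' • X) P :=
        hXi.bdd_smul 1 (hZ'm.mono (hFm s)).aestronglyMeasurable hZ'b
      have := condExp_smul_of_aestronglyMeasurable_left (m := F s) hZ'm.aestronglyMeasurable hi hXi
      calc _ = ∫ ω, (P[Z' • X | F s]) ω ∂P := (integral_congr_ae this).symm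
        _ = _ := integral_condExp (hFm s)
    -- Fubini
    have fub : ∀ Y : Ω → ℝ, StronglyMeasurable Y → (∀ᵐ ω ∂P, ‖Y ω‖ ≤ 1) →
        ∫ ω, Y ω • X ω ∂P = ∫ r in (0:ℝ)..s, ∫ ω, Y ω • w r ω ∂P := by
      intro Y hY hYb
      rw [intervalIntegral_integral_swap]
      · congr 1; ext ω
        rw [intervalIntegral.integral_smul]
      · have h1 : Integrable (Function.uncurry w) ((volume.restrict (Set.uIoc 0 s)).prod P) :=
          aux_integrable hw 0 s 1 (fun r _ ω => hb r ω)
        refine h1.bdd_smul (φ := fun q => Y q.2) 1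
          (hY.comp_measurable measurable_snd).aestronglyMeasurable ?_
        exact Measure.quasiMeasurePreserving_snd.ae hYb
    rw [hZY, hZY, pull2, fub Z hZm (ae_of_all _ hZb), fub Z' (hZ'm.mono (hFm s)) hZ'b]
    refine intervalIntegral.integral_congr fun r hr => ?_
    rw [Set.uIcc_of_le hs] at hr
    exact pull _ ((had r).mono (hF hr.2)) (hwi r)
  exact ⟨_, stronglyMeasurable_condExp, key⟩

lemma aux_decor {m : MeasurableSpace Ω} (hm : m ≤ mΩ) {W Y : Ω → H} {K D : ℝ}
    (hW : AEStronglyMeasurable[m] W P) (hWb : ∀ ω, ‖W ω‖ ≤ K)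
    (hY : Integrable Y P) (hD : ∀ᵐ ω ∂P, ‖(P[Y | m]) ω‖ ≤ D) :
    ∫ ω, inner ℝ (W ω) (Y ω) ∂P ≤ ∫ ω, ‖W ω‖ * D ∂P := by
  have hW' : AEStronglyMeasurable[mΩ] W P := hW.mono hm
  have h := condExp_aestronglyMeasurable_bilin_of_bound (innerSL ℝ (E := H)) hm hW hY K
    (ae_of_all _ hWb)
  rw [← integral_condExp hm]
  have h' : (P[fun ω => inner ℝ (W ω) (Y ω) | m]) =ᵐ[P]
      fun ω => inner ℝ (W ω) ((P[Y | m]) ω) := h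
  rw [integral_congr_ae h']
  have hWi : Integrable W P := Integrable.of_bound hW' K (ae_of_all _ hWb)
  refine integral_mono_ae ?_ (hWi.norm.mul_const D) ?_
  · exact ((innerSL ℝ (E := H)).integrable_of_bilin_of_bdd_left K hW' (ae_of_all _ hWb)
      integrable_condExp)
  · filter_upwards [hD] with ω hω
    refine (real_inner_le_norm _ _).trans ?_
    gcongr

lemma aux_main {F : ℝ → MeasurableSpace Ω} {w : ℝ → Ω → H} (hF : Monotone F)
    (hFm : ∀ t, F t ≤ mΩ) (hw : StronglyMeasurable (Function.uncurry w))
    (hb : ∀ t ω, ‖w t ω‖ ≤ 1) (had : ∀ t, StronglyMeasurable[F t] (w t))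
    {C τ : ℝ} (hC : 0 ≤ C) (hτ : 0 < τ)
    (hdec : ∀ s t : ℝ, s ≤ t →
          ∀ᵐ ω ∂P, ‖(P[w t | F s]) ω‖ ≤ C * Real.exp (-(t - s) / τ))
    (k : ℕ) {c : ℝ} (hc : 0 ≤ c)
    (ih : ∀ T : ℝ, 0 ≤ T → ∫ ω, (‖∫ t in (0:ℝ)..T, w t ω‖ ^ 2) ^ k ∂P ≤ c * T ^ k)
    (T : ℝ) (hT : 0 ≤ T) :
    ∫ ω, (‖∫ t in (0:ℝ)..T, w t ω‖ ^ 2) ^ (k + 1) ∂P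
      ≤ (2 * (k + 1) * ((2 * k + 1) * c * C * τ)) * T ^ (k + 1) := by
  have hwω : ∀ ω, StronglyMeasurable (fun r => w r ω) := fun ω =>
    hw.comp_measurable measurable_prodMk_right
  set S : ℝ → Ω → H := fun t ω => ∫ r in (0:ℝ)..t, w r ω with hS
  have hSm : StronglyMeasurable (Function.uncurry S) := aux_S_meas hw hb
  have hSb : ∀ t ω, ‖S t ω‖ ≤ |t| := fun t ω => aux_bd (u := fun r => w r ω) (fun t => hb t ω) t
  have hSb' : ∀ t, 0 ≤ t → ∀ s ∈ Set.uIoc 0 t, ∀ ω, (‖S s ω‖ ^ 2) ^ k ≤ (t ^ 2) ^ k := by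
    intro t ht s hs ω
    rw [Set.uIoc_of_le ht] at hs
    have := hSb s ω
    rw [abs_of_pos hs.1] at this
    have := this.trans hs.2
    gcongr
  have hwt : ∀ t, StronglyMeasurable (w t) := fun t => (had t).mono (hFm t)
  have hwi : ∀ r, Integrable (w r) P := fun r =>
    Integrable.of_bound (hwt r).aestronglyMeasurable 1 (ae_of_all _ (hb r))
  have hqi : ∀ s, Integrable (fun ω => (‖S s ω‖ ^ 2) ^ k) P := by
    intro s
    refine Integrable.of_bound (C := (|s| ^ 2) ^ k) ?_ (ae_of_all _ fun ω => ?_)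
    · have h1 : StronglyMeasurable (S s) := hSm.comp_measurable measurable_prodMk_left
      exact ((h1.norm.pow 2).pow k).aestronglyMeasurable
    · rw [Real.norm_of_nonneg (by positivity)]
      have := hSb s ω
      gcongr
  -- inner bound
  have inner_bd : ∀ t, 0 ≤ t → ∫ ω, (‖S t ω‖ ^ 2) ^ k * inner ℝ (S t ω) (w t ω) ∂P
      ≤ (2 * k + 1) * c * C * τ * t ^ k := by
    intro t ht
    have e1 : ∀ ω, (‖S t ω‖ ^ 2) ^ k * inner ℝ (S t ω) (w t ω) =
        ∫ s in (0:ℝ)..t, inner ℝ (auxW k (S s ω) (w s ω)) (w t ω) := fun ω =>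
      aux_path2 (hwω ω) (fun r => hb r ω) t k (w t ω)
    have hWm : StronglyMeasurable (fun q : ℝ × Ω => auxW k (S q.1 q.2) (w q.1 q.2)) :=
      (auxW_cont k).comp_stronglyMeasurable
        (f := fun q : ℝ × Ω => (S q.1 q.2, w q.1 q.2)) (hSm.prodMk hw)
    have hint : Integrable (Function.uncurry fun s ω => inner ℝ (auxW k (S s ω) (w s ω)) (w t ω))
        ((volume.restrict (Set.uIoc 0 t)).prod P) := by
      refine aux_integrable ?_ 0 t ((2 * k + 1) * (t ^ 2) ^ k) ?_
      · have h1 : StronglyMeasurable (fun q : ℝ × Ω => w t q.2) :=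
          (hwt t).comp_measurable measurable_snd
        have h2 : StronglyMeasurable (fun q : ℝ × Ω =>
          (inner ℝ (auxW k (S q.1 q.2) (w q.1 q.2)) (w t q.2) : ℝ)) := hWm.inner h1
        exact h2
      · intro s hs ω
        refine (norm_inner_le_norm _ _).trans ?_
        have h1 := auxW_bd k (S s ω) (w s ω) (hb s ω)
        have h2 := hSb' t ht s hs ω
        calc _ ≤ ‖auxW k (S s ω) (w s ω)‖ * 1 := by gcongr; exact hb t ω
          _ ≤ _ := by
            rw [mul_one]; refine h1.trans ?_; gcongr
    simp_rw [e1]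
    rw [← intervalIntegral_integral_swap hint]
    have bd : ∀ s ∈ Set.Icc 0 t, ∫ ω, inner ℝ (auxW k (S s ω) (w s ω)) (w t ω) ∂P ≤
        ((2 * k + 1) * c * C * t ^ k) * Real.exp (-(t - s) / τ) := by
      intro s hs
      have hSa : AEStronglyMeasurable[F s] (S s) P := aux_S_adapted hF hFm hw hb had s hs.1
      have hWa : AEStronglyMeasurable[F s] (fun ω => auxW k (S s ω) (w s ω)) P :=
        (auxW_cont k).comp_aestronglyMeasurable (f := fun ω => (S s ω, w s ω)) (hSa.prodMk (had s).aestronglyMeasurable)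
      have hWb : ∀ ω, ‖auxW k (S s ω) (w s ω)‖ ≤ (2 * k + 1) * (|s| ^ 2) ^ k := by
        intro ω
        refine (auxW_bd k _ _ (hb s ω)).trans ?_
        have := hSb s ω
        gcongr
      refine (aux_decor (hFm s) hWa hWb (hwi t) (hdec s t hs.2)).trans ?_
      rw [integral_mul_const]
      have h1 : ∫ ω, ‖auxW k (S s ω) (w s ω)‖ ∂P ≤ (2 * k + 1) * (c * t ^ k) := by
        calc _ ≤ ∫ ω, (2 * k + 1) * (‖S s ω‖ ^ 2) ^ k ∂P := by
              refine integral_mono_of_nonneg (ae_of_all _ fun _ => norm_nonneg _)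
                ((hqi s).const_mul _) (ae_of_all _ fun ω => auxW_bd k _ _ (hb s ω))
          _ = (2 * k + 1) * ∫ ω, (‖S s ω‖ ^ 2) ^ k ∂P := integral_const_mul _ _
          _ ≤ (2 * k + 1) * (c * s ^ k) := by
              gcongr; exact ih s hs.1
          _ ≤ _ := by
              have := hs.1
              have := hs.2
              gcongr
      calc _ ≤ (2 * k + 1) * (c * t ^ k) * (C * Real.exp (-(t - s) / τ)) := by gcongr
        _ = _ := by ring
    calc _ ≤ ∫ s in (0:ℝ)..t, ((2 * k + 1) * c * C * t ^ k) * Real.exp (-(t - s) / τ) := by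
          refine intervalIntegral.integral_mono_on ht ?_
            (Continuous.intervalIntegrable (by fun_prop) _ _) bd
          rw [intervalIntegrable_iff]
          exact hint.integral_prod_left
      _ = ((2 * k + 1) * c * C * t ^ k) * ∫ s in (0:ℝ)..t, Real.exp (-(t - s) / τ) :=
          intervalIntegral.integral_const_mul _ _
      _ ≤ ((2 * k + 1) * c * C * t ^ k) * τ := by
          have := aux_exp τ hτ t
          gcongr
      _ = _ := by ring
  -- outer
  have e2 : ∀ ω, (‖S T ω‖ ^ 2) ^ (k + 1) = ∫ t in (0:ℝ)..T, (2 * (k + 1)) *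
      ((‖S t ω‖ ^ 2) ^ k * inner ℝ (S t ω) (w t ω)) := fun ω =>
    aux_path1 (hwω ω) (fun r => hb r ω) T k
  have hint : Integrable (Function.uncurry fun t ω => (2 * ((k:ℝ) + 1)) *
      ((‖S t ω‖ ^ 2) ^ k * inner ℝ (S t ω) (w t ω)))
      ((volume.restrict (Set.uIoc 0 T)).prod P) := by
    refine aux_integrable ?_ 0 T ((2 * (k + 1)) * ((T ^ 2) ^ k * T)) ?_
    · exact (((hSm.norm.pow 2).pow k).mul (hSm.inner hw)).const_mul _
    · intro s hs ω
      have h2 := hSb' T hT s hs ω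
      have h3 : ‖(inner ℝ (S s ω) (w s ω) : ℝ)‖ ≤ T := by
        refine (norm_inner_le_norm _ _).trans ?_
        rw [Set.uIoc_of_le hT] at hs
        have h4 := hSb s ω
        rw [abs_of_pos hs.1] at h4
        have h5 := hb s ω
        have := hs.2
        nlinarith [norm_nonneg (S s ω), norm_nonneg (w s ω)]
      simp only [Function.uncurry]
      rw [norm_mul, Real.norm_of_nonneg (by positivity : (0:ℝ) ≤ 2 * ((k:ℝ) + 1)), norm_mul,
        Real.norm_of_nonneg (by positivity : (0:ℝ) ≤ (‖S s ω‖ ^ 2) ^ k)]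
      gcongr
  change ∫ ω, (‖S T ω‖ ^ 2) ^ (k + 1) ∂P ≤ _
  simp_rw [e2]
  rw [← intervalIntegral_integral_swap hint]
  calc _ ≤ ∫ t in (0:ℝ)..T, (2 * (k + 1)) * ((2 * k + 1) * c * C * τ * T ^ k) := by
        refine intervalIntegral.integral_mono_on hT ?_ intervalIntegrable_const ?_
        · rw [intervalIntegrable_iff]
          exact hint.integral_prod_left
        · intro t ht
          rw [integral_const_mul]
          have h1 := inner_bd t ht.1
          have h2 : (2 * k + 1) * c * C * τ * t ^ k ≤ (2 * k + 1) * c * C * τ * T ^ k := by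
            have := ht.1
            have := ht.2
            gcongr
          have := h1.trans h2
          gcongr
    _ = _ := by
        rw [intervalIntegral.integral_const]
        simp only [sub_zero, smul_eq_mul]
        ring

lemma aux_even {C τ : ℝ} (hC : 0 ≤ C) (hτ : 0 < τ) (k : ℕ) :
    ∃ c : ℝ, 0 ≤ c ∧ ∀ (F : ℝ → MeasurableSpace Ω) (w : ℝ → Ω → H), Monotone F →
    (∀ t, F t ≤ mΩ) → StronglyMeasurable (Function.uncurry w) →
    (∀ t ω, ‖w t ω‖ ≤ 1) → (∀ t, StronglyMeasurable[F t] (w t)) →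
    (∀ s t : ℝ, s ≤ t →
          ∀ᵐ ω ∂P, ‖(P[w t | F s]) ω‖ ≤ C * Real.exp (-(t - s) / τ)) →
    ∀ T : ℝ, 0 ≤ T → ∫ ω, (‖∫ t in (0:ℝ)..T, w t ω‖ ^ 2) ^ k ∂P ≤ c * T ^ k := by
  induction k with
  | zero => exact ⟨1, zero_le_one, fun F w _ _ _ _ _ _ T _ => by simp⟩
  | succ k ih =>
    obtain ⟨c, hc, h⟩ := ih
    exact ⟨_, by positivity, fun F w h1 h2 h3 h4 h5 h6 T hT =>
      aux_main h1 h2 h3 h4 h5 hC hτ h6 k hc (h F w h1 h2 h3 h4 h5 h6) T hT⟩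

/-- Jensen / Lyapunov -/
lemma aux_lyap {X : Ω → ℝ} (hX : StronglyMeasurable X) (h0 : ∀ ω, 0 ≤ X ω) {K : ℝ}
    (hK : ∀ ω, X ω ≤ K) {p : ℝ} (hp : 0 < p) (n : ℕ) (hn : p ≤ 2 * n) :
    ∫ ω, X ω ^ p ∂P ≤ (∫ ω, (X ω ^ 2) ^ n ∂P) ^ (p / (2 * n)) := by
  have hn0 : (0:ℝ) < 2 * n := hp.trans_le hn
  have hr : 1 ≤ 2 * n / p := (one_le_div hp).2 hn
  have e : ∀ ω, (X ω ^ p) ^ (2 * n / p) = (X ω ^ 2) ^ n := by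
    intro ω
    rw [← Real.rpow_mul (h0 ω), mul_div_cancel₀ _ hp.ne', ← pow_mul, ← Real.rpow_natCast]
    push_cast; rfl
  have hi1 : Integrable (fun ω => X ω ^ p) P := by
    refine Integrable.of_bound (C := K ^ p) ?_ (ae_of_all _ fun ω => ?_)
    · exact (hX.measurable.pow_const p).aestronglyMeasurable
    · rw [Real.norm_of_nonneg (Real.rpow_nonneg (h0 ω) _)]
      exact Real.rpow_le_rpow (h0 ω) (hK ω) hp.le
  have hi2 : Integrable (fun ω => (X ω ^ 2) ^ n) P := by
    refine Integrable.of_bound (C := (K ^ 2) ^ n) ?_ (ae_of_all _ fun ω => ?_)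
    · exact ((hX.pow 2).pow n).aestronglyMeasurable
    · have := h0 ω
      have := hK ω
      rw [Real.norm_of_nonneg (by positivity)]
      gcongr
  have J := (convexOn_rpow hr).map_integral_le (μ := P) (f := fun ω => X ω ^ p)
    (Real.continuous_rpow_const (by positivity)).continuousOn isClosed_Ici
    (ae_of_all _ fun ω => Real.rpow_nonneg (h0 ω) _) hi1 (by simpa [Function.comp_def, e] using hi2)
  simp only [e] at J
  have h00 : 0 ≤ ∫ ω, X ω ^ p ∂P := integral_nonneg fun ω => Real.rpow_nonneg (h0 ω) _
  calc _ = ((∫ ω, X ω ^ p ∂P) ^ (2 * n / p)) ^ (p / (2 * n)) := by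
        rw [← Real.rpow_mul h00]
        rw [div_mul_div_comm, mul_comm, div_self (by positivity), Real.rpow_one]
    _ ≤ _ := Real.rpow_le_rpow (Real.rpow_nonneg h00 _) J (by positivity)

end prob





/-- **Moment bound for the integral of the velocity process (key step in
Proposition 2.6).** Let `H` be a real separable Hilbert space and `v = (v t)_{t ∈ ℝ}`
an `H`-valued process on a probability space, adapted to a filtration `(F t)_{t ∈ ℝ}`,
jointly measurable, with `‖v t‖ = 1` a.s., stationary (finite-dimensional laws
invariant under time shifts), and exponentially decorrelated:
`‖E[v t | F s]‖ ≤ C·exp(−(t−s)/τ)` a.s. for all `s ≤ t`. Then for every `p ≥ 2`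
there is a constant `c`, depending only on `p`, `C`, `τ`, with
`E[‖∫_0^T v_t dt‖^p] ≤ c · T^(p/2)` for all `T ≥ 0`. -/
theorem stmt2
    {H : Type*} [NormedAddCommGroup H] [InnerProductSpace ℝ H] [CompleteSpace H]
    [SecondCountableTopology H] [MeasurableSpace H] [BorelSpace H]
    {Ω : Type*} {mΩ : MeasurableSpace Ω} (P : Measure Ω) [IsProbabilityMeasure P]
    (C τ : ℝ) (hC : 0 ≤ C) (hτ : 0 < τ)
    (p : ℝ) (hp : 2 ≤ p) :
    ∃ c : ℝ, 0 < c ∧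
      ∀ (F : ℝ → MeasurableSpace Ω) (v : ℝ → Ω → H),
        Monotone F → (∀ t : ℝ, F t ≤ mΩ) →
        StronglyMeasurable (Function.uncurry v) →
        (∀ t : ℝ, ∀ᵐ ω ∂P, ‖v t ω‖ = 1) →
        (∀ t : ℝ, StronglyMeasurable[F t] (v t)) →
        (∀ (s : ℝ) (n : ℕ) (ts : Fin n → ℝ),
          Measure.map (fun ω i => v (ts i + s) ω) P
            = Measure.map (fun ω i => v (ts i) ω) P) →
        (∀ s t : ℝ, s ≤ t →
          ∀ᵐ ω ∂P, ‖(P[v t | F s]) ω‖ ≤ C * Real.exp (-(t - s) / τ)) →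
        ∀ T : ℝ, 0 ≤ T →
          ∫ ω, ‖∫ t in (0:ℝ)..T, v t ω‖ ^ p ∂P ≤ c * T ^ (p / 2) := by
  obtain ⟨n, hn⟩ := exists_nat_ge (p / 2)
  obtain ⟨c, hc, h⟩ := aux_even (H := H) (P := P) hC hτ n
  refine ⟨c ^ (p / (2 * n)) + 1, by positivity, ?_⟩
  intro F v hF hFm hv hv1 had _ hdec T hT
  let w : ℝ → Ω → H := fun t ω => (Metric.closedBall (0:H) 1).indicator id (v t ω)
  have hind : StronglyMeasurable ((Metric.closedBall (0:H) 1).indicator (id : H → H)) :=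
    stronglyMeasurable_id.indicator Metric.isClosed_closedBall.measurableSet
  have hw : StronglyMeasurable (Function.uncurry w) := hind.comp_measurable hv.measurable
  have hwb : ∀ t ω, ‖w t ω‖ ≤ 1 := by
    intro t ω
    by_cases hh : v t ω ∈ Metric.closedBall (0:H) 1
    · simp only [w, Set.indicator_of_mem hh]
      simpa using hh
    · simp [w, Set.indicator_of_notMem hh]
  have hwa : ∀ t, StronglyMeasurable[F t] (w t) := fun t =>
    hind.comp_measurable (had t).measurable
  have hwv : ∀ t, ∀ᵐ ω ∂P, v t ω = w t ω := by
    intro t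
    filter_upwards [hv1 t] with ω hω
    have hh : v t ω ∈ Metric.closedBall (0:H) 1 := by simp [hω]
    simp [w, Set.indicator_of_mem hh]
  have hwdec : ∀ s t : ℝ, s ≤ t →
      ∀ᵐ ω ∂P, ‖(P[w t | F s]) ω‖ ≤ C * Real.exp (-(t - s) / τ) := by
    intro s t hst
    filter_upwards [hdec s t hst, condExp_congr_ae (m := F s) (hwv t)] with ω h1 h2
    rwa [← h2]
  have hSeq : ∀ᵐ ω ∂P, ∫ t in (0:ℝ)..T, v t ω = ∫ t in (0:ℝ)..T, w t ω := by
    have h1 : ∀ᵐ ω ∂P, ∀ᵐ t ∂(volume : Measure ℝ), v t ω = w t ω := by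
      rw [← Measure.ae_ae_comm (p := fun t ω => v t ω = w t ω)]
      · exact ae_of_all _ hwv
      · exact measurableSet_eq_fun hv.measurable hw.measurable
    filter_upwards [h1] with ω hω
    refine intervalIntegral.integral_congr_ae ?_
    filter_upwards [hω] with t ht _ using ht
  have hmain := h F w hF hFm hw hwb hwa hwdec T hT
  have hp0 : 0 < p := by linarith
  have hn2 : p ≤ 2 * n := by linarith
  have hn0 : (0:ℝ) < n := by linarith
  have hSm : StronglyMeasurable (fun ω => ∫ r in (0:ℝ)..T, w r ω) :=
    (aux_S_meas hw hwb).comp_measurable measurable_prodMk_left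
  have hl := aux_lyap (P := P) hSm.norm (fun ω => norm_nonneg _)
    (fun ω => aux_bd (u := fun r => w r ω) (fun t => hwb t ω) T) hp0 n hn2
  calc _ = ∫ ω, ‖∫ t in (0:ℝ)..T, w t ω‖ ^ p ∂P := by
        refine integral_congr_ae ?_
        filter_upwards [hSeq] with ω hω
        rw [hω]
    _ ≤ _ := hl
    _ ≤ (c * T ^ n) ^ (p / (2 * n)) :=
        Real.rpow_le_rpow (integral_nonneg fun ω => by positivity) hmain (by positivity)
    _ = c ^ (p / (2 * n)) * T ^ (p / 2) := by
        rw [Real.mul_rpow hc (by positivity), ← Real.rpow_natCast, ← Real.rpow_mul hT]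
        congr 2
        field_simp
    _ ≤ _ := by
        gcongr
        linarith
end

section
/- Under hypotheses (i)–(iv) on the process v, define for σ > 0 and t ≥ 0 the time-rescaled position process X^σ_t := σ^{-2} ∫_0^{σ⁴ t} v_u du (which has the law of the time-rescaled position x^σ_{σ² t} of kinetic Brownian motion in H). Then for every p ≥ 2 there exists a constant c depending only on p, C and τ such that sup_{σ > 0} E[ ‖X^σ_t − X^σ_s‖^p ] ≤ c · |t − s|^{p/2} for all 0 ≤ s ≤ t ≤ 1. -/
open MeasureTheory

namespace KBM

set_option linter.unusedSectionVars false

section Det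
variable {H : Type*} [NormedAddCommGroup H] [InnerProductSpace ℝ H] [CompleteSpace H]

theorem ii {f : ℝ → H} (hf : StronglyMeasurable f) (hb : ∀ u, ‖f u‖ ≤ 1) (a b : ℝ) :
    IntervalIntegrable f volume a b := by
  refine (intervalIntegrable_const (c := (1:ℝ))).mono_fun hf.aestronglyMeasurable ?_
  exact Filter.Eventually.of_forall fun u => by simpa using hb u

theorem lipS {f : ℝ → H} (hf : StronglyMeasurable f) (hb : ∀ u, ‖f u‖ ≤ 1) (a : ℝ) :
    LipschitzWith 1 (fun r => ∫ u in a..r, f u) := by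
  refine LipschitzWith.of_dist_le_mul fun x y => ?_
  rw [dist_eq_norm, intervalIntegral.integral_interval_sub_left (ii hf hb _ _) (ii hf hb _ _)]
  have := intervalIntegral.norm_integral_le_of_norm_le_const (f := f) (a := y) (b := x) (C := 1)
    (fun u _ => hb u)
  simpa [Real.dist_eq] using this

theorem norm_S_le {f : ℝ → H} (hb : ∀ u, ‖f u‖ ≤ 1) {a r : ℝ} (h : a ≤ r) :
    ‖∫ u in a..r, f u‖ ≤ r - a := by
  have := intervalIntegral.norm_integral_le_of_norm_le_const (f := f) (a := a) (b := r) (C := 1)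
    (fun u _ => hb u)
  rwa [one_mul, abs_of_nonneg (by linarith)] at this

theorem ac_normsq {f : ℝ → H} (hf : StronglyMeasurable f) (hb : ∀ u, ‖f u‖ ≤ 1) (a b : ℝ) (m : ℕ) :
    AbsolutelyContinuousOnInterval (fun r => (‖∫ u in a..r, f u‖ ^ 2) ^ m) a b := by
  have h1 : AbsolutelyContinuousOnInterval (fun r => ‖∫ u in a..r, f u‖) a b :=
    ((lipschitzWith_one_norm.comp (lipS hf hb a)).lipschitzOnWith).absolutelyContinuousOnInterval
  have h2 : AbsolutelyContinuousOnInterval (fun r => ‖∫ u in a..r, f u‖ ^ 2) a b := by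
    have := h1.mul h1
    simpa [pow_two, Pi.mul_def] using this
  induction m with
  | zero =>
    simp only [pow_zero]
    exact ((LipschitzWith.const (1:ℝ)).lipschitzOnWith (s := Set.uIcc a b)).absolutelyContinuousOnInterval
  | succ k ih =>
    have := ih.mul h2
    simpa [pow_succ, Pi.mul_def] using this

theorem ac_inner {f : ℝ → H} (hf : StronglyMeasurable f) (hb : ∀ u, ‖f u‖ ≤ 1) (a b : ℝ) (h : H) :
    AbsolutelyContinuousOnInterval (fun r => inner ℝ (∫ u in a..r, f u) h) a b := by
  have := ((innerSL ℝ h).lipschitz.comp (lipS hf hb a)).lipschitzOnWith (s := Set.uIcc a b)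
  have := this.absolutelyContinuousOnInterval
  simpa [Function.comp_def, real_inner_comm] using this

theorem ftc {g g' : ℝ → ℝ} {a b : ℝ} (hg : AbsolutelyContinuousOnInterval g a b)
    (hd : ∀ᵐ x, HasDerivAt g (g' x) x) : ∫ x in a..b, g' x = g b - g a := by
  rw [← hg.integral_deriv_eq_sub]
  refine intervalIntegral.integral_congr_ae ?_
  filter_upwards [hd] with x hx _ using hx.deriv.symm

theorem ae_deriv {f : ℝ → H} (hf : StronglyMeasurable f) (hb : ∀ u, ‖f u‖ ≤ 1) (a : ℝ) :
    ∀ᵐ x, HasDerivAt (fun r => ∫ u in a..r, f u) (f x) x := by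
  have : LocallyIntegrable f volume := by
    refine (locallyIntegrable_const (1:ℝ)).mono hf.aestronglyMeasurable ?_
    exact Filter.Eventually.of_forall fun u => by simpa using hb u
  filter_upwards [_root_.LocallyIntegrable.ae_hasDerivAt_integral this] with x hx using hx a

theorem det1 {f : ℝ → H} (hf : StronglyMeasurable f) (hb : ∀ u, ‖f u‖ ≤ 1) (a b : ℝ) (m : ℕ) :
    (‖∫ u in a..b, f u‖ ^ 2) ^ (m + 1) =
      ∫ t in a..b, (2 * (m + 1) : ℝ) * ((‖∫ u in a..t, f u‖ ^ 2) ^ m *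
        inner ℝ (∫ u in a..t, f u) (f t)) := by
  rw [ftc (ac_normsq hf hb a b (m+1))]
  · simp
  · filter_upwards [ae_deriv hf hb a] with x hx
    have := (hx.norm_sq).pow (m+1)
    refine this.congr_deriv ?_
    simp only [Nat.add_sub_cancel]
    push_cast
    ring

/-- The vector `W_r`. -/
noncomputable def W (m : ℕ) (S f : H) : H :=
  (m * (‖S‖ ^ 2) ^ (m - 1) * (2 * inner ℝ S f)) • S + ((‖S‖ ^ 2) ^ m) • f

theorem W_cont (m : ℕ) : Continuous (fun q : H × H => W m q.1 q.2) := by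
  unfold W
  fun_prop

theorem W_norm (m : ℕ) (S f : H) (hf : ‖f‖ ≤ 1) : ‖W m S f‖ ≤ (2 * m + 1) * (‖S‖ ^ 2) ^ m := by
  unfold W
  refine (norm_add_le _ _).trans ?_
  rw [norm_smul, norm_smul]
  have hi : |inner ℝ S f| ≤ ‖S‖ := by
    refine (abs_real_inner_le_norm S f).trans ?_
    nlinarith [norm_nonneg S]
  have h0 := norm_nonneg S
  have e2 : ‖(‖S‖ ^ 2) ^ m‖ * ‖f‖ ≤ (‖S‖ ^ 2) ^ m := by
    rw [Real.norm_of_nonneg (by positivity)]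
    exact mul_le_of_le_one_right (by positivity) hf
  have e1 : ‖(m * (‖S‖ ^ 2) ^ (m - 1) * (2 * inner ℝ S f) : ℝ)‖ * ‖S‖ ≤ 2 * m * (‖S‖ ^ 2) ^ m := by
    rw [norm_mul, norm_mul (2:ℝ), Real.norm_of_nonneg (by positivity), Real.norm_eq_abs (inner ℝ S f)]
    cases m with
    | zero => simp
    | succ k =>
      simp only [Nat.add_sub_cancel]
      calc _ ≤ ((k+1 : ℕ) : ℝ) * (‖S‖ ^ 2) ^ k * (‖(2:ℝ)‖ * ‖S‖) * ‖S‖ := by gcongr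
        _ = _ := by rw [Real.norm_of_nonneg (by norm_num)]; ring
  linarith

theorem det2 {f : ℝ → H} (hf : StronglyMeasurable f) (hb : ∀ u, ‖f u‖ ≤ 1) (a b : ℝ) (m : ℕ) (h : H) :
    (‖∫ u in a..b, f u‖ ^ 2) ^ m * inner ℝ (∫ u in a..b, f u) h =
      ∫ t in a..b, inner ℝ (W m (∫ u in a..t, f u) (f t)) h := by
  rw [ftc ((ac_normsq hf hb a b m).mul (ac_inner hf hb a b h))]
  · simp
  · filter_upwards [ae_deriv hf hb a] with x hx
    have := ((hx.norm_sq).pow m).mul (hx.inner ℝ (hasDerivAt_const x h))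
    refine this.congr_deriv ?_
    simp only [W, inner_add_left, real_inner_smul_left, inner_zero_right, zero_add]
    rfl

end Det

section Prob

variable {H : Type*} [NormedAddCommGroup H] [InnerProductSpace ℝ H] [CompleteSpace H]
  {Ω : Type*} {mΩ : MeasurableSpace Ω} {P : Measure Ω} [IsProbabilityMeasure P]

theorem S_sm1 {w : ℝ → Ω → H} (hw : StronglyMeasurable (Function.uncurry w)) (a r : ℝ) :
    StronglyMeasurable (fun ω => ∫ u in a..r, w u ω) := by
  simp only [intervalIntegral]
  have h : StronglyMeasurable (fun q : Ω × ℝ => w q.2 q.1) := hw.comp_measurable measurable_swap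
  exact (h.integral_prod_right' (ν := volume.restrict (Set.Ioc a r))).sub
    (h.integral_prod_right' (ν := volume.restrict (Set.Ioc r a)))

theorem path_sm {w : ℝ → Ω → H} (hw : StronglyMeasurable (Function.uncurry w)) (ω : Ω) :
    StronglyMeasurable (fun u => w u ω) :=
  hw.comp_measurable (measurable_id.prodMk measurable_const)

theorem S_sm {w : ℝ → Ω → H} (hw : StronglyMeasurable (Function.uncurry w))
    (hb : ∀ u ω, ‖w u ω‖ ≤ 1) (a : ℝ) :
    StronglyMeasurable (fun q : ℝ × Ω => ∫ u in a..q.1, w u q.2) :=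
  stronglyMeasurable_uncurry_of_continuous_of_stronglyMeasurable
    (u := fun r ω => ∫ u in a..r, w u ω)
    (fun ω => (lipS (path_sm hw ω) (fun u => hb u ω) a).continuous) (fun r => S_sm1 hw a r)

theorem fub_int {g : ℝ → Ω → ℝ} (hg : StronglyMeasurable (Function.uncurry g)) {B : Ω → ℝ}
    (hB : Integrable B P) {a b : ℝ} (hbd : ∀ t ∈ Set.Ioc a b, ∀ ω, |g t ω| ≤ B ω) :
    Integrable (Function.uncurry g) ((volume.restrict (Set.Ioc a b)).prod P) := by
  refine (hB.comp_snd (volume.restrict (Set.Ioc a b))).mono' hg.aestronglyMeasurable ?_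
  have e : (volume.restrict (Set.Ioc a b)).prod P
      = ((volume : Measure ℝ).prod P).restrict (Set.Ioc a b ×ˢ Set.univ) := by
    rw [← Measure.prod_restrict, Measure.restrict_univ]
  rw [e]
  filter_upwards [ae_restrict_mem (measurableSet_Ioc.prod MeasurableSet.univ)] with q hq
  exact hbd q.1 hq.1 q.2

theorem fub {g : ℝ → Ω → ℝ} (hg : StronglyMeasurable (Function.uncurry g)) {B : Ω → ℝ}
    (hB : Integrable B P) {a b : ℝ} (hab : a ≤ b)
    (hbd : ∀ t ∈ Set.Ioc a b, ∀ ω, |g t ω| ≤ B ω) :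
    ∫ ω, (∫ t in a..b, g t ω) ∂P = ∫ t in a..b, ∫ ω, g t ω ∂P := by
  simp only [intervalIntegral.integral_of_le hab]
  exact (integral_integral_swap (fub_int hg hB hbd)).symm

theorem orth {m : MeasurableSpace Ω} (hm : m ≤ mΩ) {h X : Ω → H}
    (hh : AEStronglyMeasurable[m] h P) {c : ℝ} (hc : ∀ᵐ ω ∂P, ‖h ω‖ ≤ c) (hX : Integrable X P) :
    ∫ ω, inner ℝ (h ω) (X ω) ∂P = ∫ ω, inner ℝ (h ω) ((P[X | m]) ω) ∂P := by
  have := condExp_aestronglyMeasurable_bilin_of_bound (innerSL ℝ) hm hh hX c hc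
  rw [← integral_condExp hm]
  exact integral_congr_ae this

theorem int_inner {h X : Ω → H} (hh : AEStronglyMeasurable h P) {c : ℝ}
    (hc : ∀ᵐ ω ∂P, ‖h ω‖ ≤ c) (hX : Integrable X P) :
    Integrable (fun ω => inner ℝ (h ω) (X ω)) P := by
  refine (hX.norm.const_mul c).mono' (hh.inner hX.aestronglyMeasurable) ?_
  filter_upwards [hc] with ω hω
  refine (norm_inner_le_norm _ _).trans ?_
  gcongr

theorem adapt {w : ℝ → Ω → H} (hw : StronglyMeasurable (Function.uncurry w))
    (hb : ∀ u ω, ‖w u ω‖ ≤ 1) {F : ℝ → MeasurableSpace Ω} (hF : Monotone F)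
    (hle : ∀ t, F t ≤ mΩ) (had : ∀ t, StronglyMeasurable[F t] (w t)) {a r : ℝ} (har : a ≤ r) :
    AEStronglyMeasurable[F r] (fun ω => ∫ u in a..r, w u ω) P := by
  set S : Ω → H := fun ω => ∫ u in a..r, w u ω with hS
  have hSm : StronglyMeasurable S := S_sm1 hw a r
  have hSb : ∀ ω, ‖S ω‖ ≤ r - a := fun ω => norm_S_le (fun u => hb u ω) har
  have hSi : Integrable S P := Integrable.of_bound hSm.aestronglyMeasurable (r - a) (.of_forall hSb)
  set Y : Ω → H := P[S | F r] with hY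
  have hYm : StronglyMeasurable[F r] Y := stronglyMeasurable_condExp
  have hYi : Integrable Y P := integrable_condExp
  have hYb : ∀ᵐ ω ∂P, ‖Y ω‖ ≤ r - a := ae_bdd_norm_condExp_of_ae_bdd_norm (.of_forall hSb)
  set Z : Ω → H := fun ω => S ω - Y ω with hZ
  have hZm : StronglyMeasurable Z := hSm.sub (hYm.mono (hle r))
  have hZi : Integrable Z P := hSi.sub hYi
  have key : ∀ (h : Ω → H) (c : ℝ), StronglyMeasurable[F r] h → (∀ᵐ ω ∂P, ‖h ω‖ ≤ c) →
      ∫ ω, inner ℝ (h ω) (Z ω) ∂P = 0 := by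
    intro h c hh hc
    have hh' : AEStronglyMeasurable h P := (hh.mono (hle r)).aestronglyMeasurable
    simp only [hZ, inner_sub_right]
    rw [integral_sub (int_inner hh' hc hSi) (int_inner hh' hc hYi),
      orth (hle r) hh.aestronglyMeasurable hc hSi, sub_self]
  have k1 : ∫ ω, inner ℝ (Y ω) (Z ω) ∂P = 0 := key Y _ hYm hYb
  have k2 : ∫ ω, inner ℝ (S ω) (Z ω) ∂P = 0 := by
    have e : ∀ ω, inner ℝ (S ω) (Z ω) = ∫ u in a..r, inner ℝ (w u ω) (Z ω) := by
      intro ω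
      have := (innerSL ℝ (Z ω)).intervalIntegral_comp_comm
        (ii (path_sm hw ω) (fun u => hb u ω) a r)
      simp only [innerSL_apply_apply] at this
      simp only [hS]
      rw [real_inner_comm, ← this]
      simp only [real_inner_comm]
    simp only [e]
    rw [fub (B := fun ω => ‖Z ω‖) _ hZi.norm har]
    · refine intervalIntegral.integral_zero_ae (.of_forall fun u hu => ?_)
      rw [Set.uIoc_of_le har] at hu
      exact key (w u) 1 ((had u).mono (hF hu.2)) (.of_forall (hb u))
    · intro t _ ω
      refine (abs_real_inner_le_norm _ _).trans ?_
      exact mul_le_of_le_one_left (norm_nonneg _) (hb t ω)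
    · exact hw.inner (hZm.comp_measurable measurable_snd)
  have k3 : ∫ ω, ‖Z ω‖ ^ 2 ∂P = 0 := by
    have e : ∀ ω, ‖Z ω‖ ^ 2 = inner ℝ (S ω) (Z ω) - inner ℝ (Y ω) (Z ω) := by
      intro ω
      rw [← inner_sub_left, ← real_inner_self_eq_norm_sq]
    simp only [e]
    rw [integral_sub (int_inner hSm.aestronglyMeasurable (.of_forall hSb) hZi)
      (int_inner (hYm.mono (hle r)).aestronglyMeasurable hYb hZi), k1, k2, sub_zero]
  have hZ2 : Integrable (fun ω => ‖Z ω‖ ^ 2) P := by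
    refine Integrable.of_bound (hZm.norm.pow 2).aestronglyMeasurable ((r - a + (r - a)) ^ 2) ?_
    filter_upwards [hYb] with ω hω
    rw [Real.norm_of_nonneg (by positivity)]
    have : ‖Z ω‖ ≤ r - a + (r - a) := (norm_sub_le _ _).trans (add_le_add (hSb ω) hω)
    gcongr
  rw [integral_eq_zero_iff_of_nonneg (fun ω => by positivity) hZ2] at k3
  refine ⟨Y, hYm, ?_⟩
  filter_upwards [k3] with ω hω
  have : ‖Z ω‖ ^ 2 = 0 := hω
  exact sub_eq_zero.1 (by simpa using this)

/-- The constants. -/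
noncomputable def K (C τ : ℝ) : ℕ → ℝ
  | 0 => 1
  | m + 1 => (2 * (m + 1)) * ((2 * m + 1) * K C τ m * C * τ)

theorem K_nonneg {C τ : ℝ} (hC : 0 ≤ C) (hτ : 0 < τ) (m : ℕ) : 0 ≤ K C τ m := by
  induction m with
  | zero => simp [K]
  | succ k ih => simp only [K]; positivity

theorem exp_int {τ : ℝ} (hτ : 0 < τ) (a t : ℝ) :
    ∫ r in a..t, Real.exp (-(t - r) / τ) ≤ τ := by
  have hd : ∀ r ∈ Set.uIcc a t, HasDerivAt (fun r => τ * Real.exp (-(t - r) / τ))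
      (Real.exp (-(t - r) / τ)) r := by
    intro r _
    have h1 : HasDerivAt (fun r => -(t - r) / τ) (1 / τ) r := by
      have := (((hasDerivAt_id r).const_sub t).neg).div_const τ
      simpa using this
    refine (h1.exp.const_mul τ).congr_deriv ?_
    field_simp
  rw [intervalIntegral.integral_eq_sub_of_hasDerivAt hd
    (Continuous.intervalIntegrable (by fun_prop) _ _)]
  have : 0 < Real.exp (-(t - a) / τ) := Real.exp_pos _
  have h2 : 0 < τ * Real.exp (-(t - a) / τ) := mul_pos hτ this
  simp only [sub_self, neg_zero, zero_div, Real.exp_zero]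
  linarith

theorem core {w : ℝ → Ω → H} (hw : StronglyMeasurable (Function.uncurry w))
    (hb : ∀ u ω, ‖w u ω‖ ≤ 1) {F : ℝ → MeasurableSpace Ω} (hF : Monotone F)
    (hle : ∀ t, F t ≤ mΩ) (had : ∀ t, StronglyMeasurable[F t] (w t))
    {C τ : ℝ} (hC : 0 ≤ C) (hτ : 0 < τ)
    (hdec : ∀ s t : ℝ, s ≤ t →
          ∀ᵐ ω ∂P, ‖(P[w t | F s]) ω‖ ≤ C * Real.exp (-(t - s) / τ)) (a : ℝ) (m : ℕ) :
    ∀ b, a ≤ b → ∫ ω, (‖∫ u in a..b, w u ω‖ ^ 2) ^ m ∂P ≤ K C τ m * (b - a) ^ m := by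
  induction m with
  | zero => intro b _; simp [K]
  | succ m ih =>
    intro b hab
    have hSb : ∀ r, a ≤ r → ∀ ω, ‖∫ u in a..r, w u ω‖ ≤ r - a :=
      fun r hr ω => norm_S_le (fun u => hb u ω) hr
    have hSm := S_sm hw hb a
    have hNb : ∀ n : ℕ, ∀ r ∈ Set.Ioc a b, ∀ ω, (‖∫ u in a..r, w u ω‖ ^ 2) ^ n ≤ ((b - a) ^ 2) ^ n := by
      intro n r hr ω
      have := (hSb r hr.1.le ω).trans (sub_le_sub_right hr.2 a)
      gcongr
    have hNi : ∀ n : ℕ, ∀ r ∈ Set.Ioc a b, Integrable (fun ω => (‖∫ u in a..r, w u ω‖ ^ 2) ^ n) P := by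
      intro n r hr
      refine Integrable.of_bound (((S_sm1 hw a r).norm.pow 2).pow n).aestronglyMeasurable
        (((b - a) ^ 2) ^ n) (.of_forall fun ω => ?_)
      rw [Real.norm_of_nonneg (by positivity)]
      exact hNb n r hr ω
    have hWm : StronglyMeasurable (fun q : ℝ × Ω => W m (∫ u in a..q.1, w u q.2) (w q.1 q.2)) :=
      Continuous.comp_stronglyMeasurable (g := fun q : H × H => W m q.1 q.2)
        (f := fun q : ℝ × Ω => ((∫ u in a..q.1, w u q.2), w q.1 q.2)) (W_cont m) (hSm.prodMk hw)
    -- inner bound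
    have inner_bound : ∀ t ∈ Set.Ioc a b,
        ∫ ω, (‖∫ u in a..t, w u ω‖ ^ 2) ^ m * inner ℝ (∫ u in a..t, w u ω) (w t ω) ∂P
          ≤ (2 * m + 1) * (K C τ m * (b - a) ^ m) * C * τ := by
      intro t ht
      have hwt : StronglyMeasurable (w t) := (had t).mono (hle t)
      have hwi : Integrable (w t) P :=
        Integrable.of_bound hwt.aestronglyMeasurable 1 (.of_forall (hb t))
      have e : ∀ ω, (‖∫ u in a..t, w u ω‖ ^ 2) ^ m * inner ℝ (∫ u in a..t, w u ω) (w t ω)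
          = ∫ r in a..t, inner ℝ (W m (∫ u in a..r, w u ω) (w r ω)) (w t ω) :=
        fun ω => det2 (path_sm hw ω) (fun u => hb u ω) a t m (w t ω)
      simp only [e]
      have hmeas : StronglyMeasurable (Function.uncurry fun r ω =>
          inner ℝ (W m (∫ u in a..r, w u ω) (w r ω)) (w t ω)) :=
        hWm.inner (hwt.comp_measurable measurable_snd)
      have hWb : ∀ r ∈ Set.Ioc a b, ∀ ω, ‖W m (∫ u in a..r, w u ω) (w r ω)‖
          ≤ (2 * m + 1) * ((b - a) ^ 2) ^ m := by
        intro r hr ω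
        refine (W_norm m _ _ (hb r ω)).trans ?_
        have := hNb m r hr ω
        gcongr
      have hbd : ∀ r ∈ Set.Ioc a t, ∀ ω,
          |inner ℝ (W m (∫ u in a..r, w u ω) (w r ω)) (w t ω)| ≤ (2 * m + 1) * ((b - a) ^ 2) ^ m := by
        intro r hr ω
        refine (abs_real_inner_le_norm _ _).trans ?_
        refine (mul_le_of_le_one_right (norm_nonneg _) (hb t ω)).trans ?_
        exact hWb r ⟨hr.1, hr.2.trans ht.2⟩ ω
      rw [fub (B := fun _ => (2 * m + 1) * ((b - a) ^ 2) ^ m) hmeas (integrable_const _) ht.1.le hbd]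
      have hpt : ∀ r ∈ Set.Ioc a t, ∫ ω, inner ℝ (W m (∫ u in a..r, w u ω) (w r ω)) (w t ω) ∂P
          ≤ (2 * m + 1) * (K C τ m * (b - a) ^ m) * C * Real.exp (-(t - r) / τ) := by
        intro r hr
        have hr' : r ∈ Set.Ioc a b := ⟨hr.1, hr.2.trans ht.2⟩
        have hWa : AEStronglyMeasurable[F r] (fun ω => W m (∫ u in a..r, w u ω) (w r ω)) P :=
          Continuous.comp_aestronglyMeasurable (g := fun q : H × H => W m q.1 q.2)
            (f := fun ω : Ω => ((∫ u in a..r, w u ω), w r ω)) (W_cont m)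
            ((adapt hw hb hF hle had hr.1.le).prodMk (had r).aestronglyMeasurable)
        rw [orth (hle r) hWa (.of_forall (hWb r hr')) hwi]
        calc _ ≤ ∫ ω, ((2 * m + 1) * (C * Real.exp (-(t - r) / τ))) *
                  (‖∫ u in a..r, w u ω‖ ^ 2) ^ m ∂P := by
              refine integral_mono_ae (int_inner (hWa.mono (hle r)) (.of_forall (hWb r hr'))
                integrable_condExp) ((hNi m r hr').const_mul _) ?_
              filter_upwards [hdec r t hr.2] with ω hω
              refine (real_inner_le_norm _ _).trans ?_
              calc _ ≤ ((2 * m + 1) * (‖∫ u in a..r, w u ω‖ ^ 2) ^ m) *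
                    (C * Real.exp (-(t - r) / τ)) := by
                    gcongr
                    exact W_norm m _ _ (hb r ω)
                _ = _ := by ring
          _ = ((2 * m + 1) * (C * Real.exp (-(t - r) / τ))) *
                  ∫ ω, (‖∫ u in a..r, w u ω‖ ^ 2) ^ m ∂P := integral_const_mul _ _
          _ ≤ ((2 * m + 1) * (C * Real.exp (-(t - r) / τ))) * (K C τ m * (b - a) ^ m) := by
              have h1 := ih r hr.1.le
              have h2 : K C τ m * (r - a) ^ m ≤ K C τ m * (b - a) ^ m := by
                have := K_nonneg hC hτ m
                have h3 : 0 ≤ r - a := sub_nonneg.2 hr.1.le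
                have h4 := hr'.2
                gcongr
              have := h1.trans h2
              gcongr
          _ = _ := by ring
      calc _ ≤ ∫ r in a..t, (2 * m + 1) * (K C τ m * (b - a) ^ m) * C * Real.exp (-(t - r) / τ) := by
            refine intervalIntegral.integral_mono_on_of_le_Ioo ht.1.le ?_ ?_ ?_
            · rw [intervalIntegrable_iff_integrableOn_Ioc_of_le ht.1.le]
              exact (fub_int hmeas (integrable_const _) hbd).integral_prod_left
            · exact Continuous.intervalIntegrable (by fun_prop) _ _
            · intro r hr
              exact hpt r ⟨hr.1, hr.2.le⟩
        _ = (2 * m + 1) * (K C τ m * (b - a) ^ m) * C * ∫ r in a..t, Real.exp (-(t - r) / τ) :=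
            intervalIntegral.integral_const_mul _ _
        _ ≤ _ := by
            have := K_nonneg hC hτ m
            have h3 : 0 ≤ b - a := sub_nonneg.2 hab
            have := exp_int hτ a t
            gcongr
    have e : ∀ ω, (‖∫ u in a..b, w u ω‖ ^ 2) ^ (m + 1) =
      ∫ t in a..b, (2 * (m + 1) : ℝ) * ((‖∫ u in a..t, w u ω‖ ^ 2) ^ m *
        inner ℝ (∫ u in a..t, w u ω) (w t ω)) :=
      fun ω => det1 (path_sm hw ω) (fun u => hb u ω) a b m
    simp only [e]
    have hmeas : StronglyMeasurable (Function.uncurry fun t ω =>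
        (2 * (m + 1) : ℝ) * ((‖∫ u in a..t, w u ω‖ ^ 2) ^ m *
        inner ℝ (∫ u in a..t, w u ω) (w t ω))) :=
      (((hSm.norm.pow 2).pow m).mul (hSm.inner hw)).const_mul _
    have hbd : ∀ t ∈ Set.Ioc a b, ∀ ω, |(2 * (m + 1) : ℝ) * ((‖∫ u in a..t, w u ω‖ ^ 2) ^ m *
        inner ℝ (∫ u in a..t, w u ω) (w t ω))| ≤ (2 * (m + 1)) * (((b - a) ^ 2) ^ m * (b - a)) := by
      intro t ht ω
      rw [abs_mul, abs_of_nonneg (by positivity : (0:ℝ) ≤ 2 * (m + 1)), abs_mul,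
        abs_of_nonneg (by positivity : (0:ℝ) ≤ (‖∫ u in a..t, w u ω‖ ^ 2) ^ m)]
      have h1 := hNb m t ht ω
      have h2 : |inner ℝ (∫ u in a..t, w u ω) (w t ω)| ≤ b - a := by
        refine (abs_real_inner_le_norm _ _).trans ?_
        refine (mul_le_of_le_one_right (norm_nonneg _) (hb t ω)).trans ?_
        exact (hSb t ht.1.le ω).trans (sub_le_sub_right ht.2 a)
      gcongr
    rw [fub hmeas (integrable_const _) hab hbd]
    calc _ ≤ ∫ _ in a..b, (2 * (m + 1)) * ((2 * m + 1) * (K C τ m * (b - a) ^ m) * C * τ) := by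
          refine intervalIntegral.integral_mono_on_of_le_Ioo hab ?_ (by simp) ?_
          · rw [intervalIntegrable_iff_integrableOn_Ioc_of_le hab]
            exact (fub_int hmeas (integrable_const _) hbd).integral_prod_left
          · intro t ht
            rw [integral_const_mul]
            have := inner_bound t ⟨ht.1, ht.2.le⟩
            gcongr
      _ = _ := by
          rw [intervalIntegral.integral_const]
          simp only [K, smul_eq_mul]
          ring

end Prob

end KBM

theorem stmt3
    {H : Type*} [NormedAddCommGroup H] [InnerProductSpace ℝ H] [CompleteSpace H]
    [SecondCountableTopology H] [MeasurableSpace H] [BorelSpace H]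
    {Ω : Type*} {mΩ : MeasurableSpace Ω} (P : Measure Ω) [IsProbabilityMeasure P]
    (C τ : ℝ) (hC : 0 ≤ C) (hτ : 0 < τ)
    (p : ℝ) (hp : 2 ≤ p) :
    ∃ c : ℝ, 0 < c ∧
      ∀ (F : ℝ → MeasurableSpace Ω) (v : ℝ → Ω → H),
        Monotone F → (∀ t : ℝ, F t ≤ mΩ) →
        StronglyMeasurable (Function.uncurry v) →
        (∀ t : ℝ, ∀ᵐ ω ∂P, ‖v t ω‖ = 1) →
        (∀ t : ℝ, StronglyMeasurable[F t] (v t)) →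
        (∀ (s : ℝ) (n : ℕ) (ts : Fin n → ℝ),
          Measure.map (fun ω i => v (ts i + s) ω) P
            = Measure.map (fun ω i => v (ts i) ω) P) →
        (∀ s t : ℝ, s ≤ t →
          ∀ᵐ ω ∂P, ‖(P[v t | F s]) ω‖ ≤ C * Real.exp (-(t - s) / τ)) →
        ∀ σ : ℝ, 0 < σ → ∀ s t : ℝ, 0 ≤ s → s ≤ t → t ≤ 1 →
          ∫ ω, ‖(σ ^ 2)⁻¹ • (∫ u in (0:ℝ)..(σ ^ 4 * t), v u ω)
                - (σ ^ 2)⁻¹ • (∫ u in (0:ℝ)..(σ ^ 4 * s), v u ω)‖ ^ p ∂P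
            ≤ c * (t - s) ^ (p / 2) := by
  set n : ℕ := ⌈p⌉₊ with hn
  have hpn : p ≤ n := Nat.le_ceil p
  have hK := KBM.K_nonneg hC hτ n
  refine ⟨1 + KBM.K C τ n, by positivity, ?_⟩
  intro F v hF hle hv hv1 had _ hdec σ hσ s t hs hst ht
  have hp0 : p ≠ 0 := by linarith
  rcases hst.eq_or_lt with rfl | hlt
  · simp [Real.zero_rpow hp0, Real.zero_rpow (show p / 2 ≠ 0 by positivity)]
  -- truncated process
  set w : ℝ → Ω → H := fun u ω => if ‖v u ω‖ ≤ 1 then v u ω else 0 with hwdef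
  have hb : ∀ u ω, ‖w u ω‖ ≤ 1 := by
    intro u ω
    simp only [hwdef]
    split_ifs with h
    · exact h
    · simp
  have hw : StronglyMeasurable (Function.uncurry w) :=
    StronglyMeasurable.ite (p := fun q : ℝ × Ω => ‖v q.1 q.2‖ ≤ 1)
      (measurableSet_le hv.norm.measurable measurable_const) hv stronglyMeasurable_const
  have hwad : ∀ u, StronglyMeasurable[F u] (w u) := fun u =>
    StronglyMeasurable.ite (p := fun ω : Ω => ‖v u ω‖ ≤ 1)
      (measurableSet_le (had u).norm.measurable measurable_const) (had u)
        stronglyMeasurable_const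
  have hwv : ∀ u, w u =ᵐ[P] v u := by
    intro u
    filter_upwards [hv1 u] with ω hω
    simp [hwdef, hω]
  have hwdec : ∀ s t : ℝ, s ≤ t →
          ∀ᵐ ω ∂P, ‖(P[w t | F s]) ω‖ ≤ C * Real.exp (-(t - s) / τ) := by
    intro s t hst
    filter_upwards [hdec s t hst, condExp_congr_ae (m := F s) (hwv t)] with ω h1 h2
    rw [h2]; exact h1
  have hpath : ∀ᵐ ω ∂P, ∀ᵐ u : ℝ, w u ω = v u ω := by
    have hms : MeasurableSet {q : ℝ × Ω | w q.1 q.2 = v q.1 q.2} :=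
      hw.measurableSet_eq_fun hv
    exact (Measure.ae_ae_comm (μ := (volume : Measure ℝ)) (ν := P) hms).1 (.of_forall hwv)
  have hσ4 : 0 < σ ^ 4 := by positivity
  set D := t - s with hD
  have hDpos : 0 < D := sub_pos.2 hlt
  set Y : Ω → H := fun ω => ∫ u in (σ ^ 4 * s)..(σ ^ 4 * t), w u ω with hY
  have hab : σ ^ 4 * s ≤ σ ^ 4 * t := by gcongr
  have hYb : ∀ ω, ‖Y ω‖ ≤ σ ^ 4 * t - σ ^ 4 * s := fun ω => KBM.norm_S_le (fun u => hb u ω) hab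
  have hYm : StronglyMeasurable Y := KBM.S_sm1 hw _ _
  have hmom := KBM.core hw hb hF hle hwad hC hτ hwdec (σ ^ 4 * s) n (σ ^ 4 * t) hab
  have e1 : ∀ᵐ ω ∂P, ‖(σ ^ 2)⁻¹ • (∫ u in (0:ℝ)..(σ ^ 4 * t), v u ω)
                - (σ ^ 2)⁻¹ • (∫ u in (0:ℝ)..(σ ^ 4 * s), v u ω)‖ ^ p
        ≤ D ^ (p / 2) * (1 + ((σ ^ 4 * D) ^ n)⁻¹ * (‖Y ω‖ ^ 2) ^ n) := by
    filter_upwards [hpath] with ω hω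
    have e2 : ∀ b, ∫ u in (0:ℝ)..b, v u ω = ∫ u in (0:ℝ)..b, w u ω := by
      intro b
      refine intervalIntegral.integral_congr_ae ?_
      filter_upwards [hω] with u hu _ using hu.symm
    have hii := fun a b => KBM.ii (KBM.path_sm hw ω) (fun u => hb u ω) a b
    rw [e2, e2, ← smul_sub, intervalIntegral.integral_interval_sub_left (hii _ _) (hii _ _),
      norm_smul, Real.norm_of_nonneg (by positivity)]
    change ((σ ^ 2)⁻¹ * ‖Y ω‖) ^ p ≤ _
    set x := (σ ^ 2)⁻¹ * ‖Y ω‖ with hx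
    have hx0 : 0 ≤ x := by positivity
    set y := x / √D with hy
    have hy0 : 0 ≤ y := by positivity
    have hsD : 0 < √D := Real.sqrt_pos.2 hDpos
    have hxy : x = √D * y := by rw [hy]; field_simp
    have hy2 : y ^ 2 = (σ ^ 4 * D)⁻¹ * ‖Y ω‖ ^ 2 := by
      rw [hy, div_pow, Real.sq_sqrt hDpos.le, hx]
      field_simp
    have hyp : y ^ p ≤ 1 + (y ^ 2) ^ n := by
      rcases le_total y 1 with h | h
      · have := Real.rpow_le_one hy0 h (by linarith : 0 ≤ p)
        have : 0 ≤ (y ^ 2) ^ n := by positivity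
        linarith
      · have h1 : y ^ p ≤ y ^ ((2 * n : ℕ) : ℝ) := by
          refine Real.rpow_le_rpow_of_exponent_le h ?_
          push_cast
          linarith
        rw [Real.rpow_natCast, pow_mul] at h1
        linarith
    have hDp : (√D) ^ p = D ^ (p / 2) := by
      rw [Real.sqrt_eq_rpow, ← Real.rpow_mul hDpos.le]
      congr 1
      ring
    rw [hxy, Real.mul_rpow hsD.le hy0, hDp, ← inv_pow, ← mul_pow, ← hy2]
    gcongr
  have hN : Integrable (fun ω => (‖Y ω‖ ^ 2) ^ n) P := by
    refine Integrable.of_bound ((hYm.norm.pow 2).pow n).aestronglyMeasurable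
      (((σ ^ 4 * t - σ ^ 4 * s) ^ 2) ^ n) (.of_forall fun ω => ?_)
    rw [Real.norm_of_nonneg (by positivity)]
    have := hYb ω
    gcongr
  have hint : Integrable (fun ω => D ^ (p / 2) * (1 + ((σ ^ 4 * D) ^ n)⁻¹ * (‖Y ω‖ ^ 2) ^ n)) P :=
    ((integrable_const (1:ℝ)).add (hN.const_mul _)).const_mul _
  calc _ ≤ ∫ ω, D ^ (p / 2) * (1 + ((σ ^ 4 * D) ^ n)⁻¹ * (‖Y ω‖ ^ 2) ^ n) ∂P := by
        refine integral_mono_of_nonneg (.of_forall fun ω => ?_) hint e1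
        positivity
    _ = D ^ (p / 2) * (1 + ((σ ^ 4 * D) ^ n)⁻¹ * ∫ ω, (‖Y ω‖ ^ 2) ^ n ∂P) := by
        rw [integral_const_mul, integral_add (integrable_const _) (hN.const_mul _),
          integral_const_mul]
        simp
    _ ≤ D ^ (p / 2) * (1 + ((σ ^ 4 * D) ^ n)⁻¹ * (KBM.K C τ n * (σ ^ 4 * D) ^ n)) := by
        have : ∫ ω, (‖Y ω‖ ^ 2) ^ n ∂P ≤ KBM.K C τ n * (σ ^ 4 * D) ^ n := by
          rw [hD, mul_sub]; exact hmom
        gcongr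
    _ = _ := by
        field_simp
end

section
/- Assume α_0 > 0 (so that γ({0}) = 0). Let N ≥ 1 and let g : ℝ^N → ℝ be a C^∞ function with compact support, with first partial derivatives ∂_n g and second partial derivatives ∂_n² g. Then each of the three functions u ↦ ‖u‖ · Σ_{n<N} α_n² (∂_n² g)(u_0,…,u_{N−1}), u ↦ ‖u‖ · Σ_{n<N} u_n (∂_n g)(u_0,…,u_{N−1}), and u ↦ ‖u‖^{−1} · Σ_{n<N} α_n² u_n (∂_n g)(u_0,…,u_{N−1}) is γ-integrable, and ∫_H [ ‖u‖ Σ_{n<N} α_n² (∂_n² g)(u_0,…,u_{N−1}) − ‖u‖ Σ_{n<N} u_n (∂_n g)(u_0,…,u_{N−1}) + ‖u‖^{−1} Σ_{n<N} α_n² u_n (∂_n g)(u_0,…,u_{N−1}) ] γ(du) = 0. -/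
open MeasureTheory
open scoped RealInnerProductSpace
open ProbabilityTheory

lemma aux_stein (v : NNReal) (f f' : ℝ → ℝ) (hf : ∀ s, HasDerivAt f (f' s) s)
    (hf' : Continuous f') (hc : HasCompactSupport f) :
    ∫ s, (s * f s - v * f' s) ∂(gaussianReal 0 v) = 0 := by
  by_cases hv : v = 0
  · subst hv
    simp
  have hfc : Continuous f := continuous_iff_continuousAt.2 fun s => (hf s).continuousAt
  have hder : f' = deriv f := by
    ext s; exact (hf s).deriv.symm
  have hc' : HasCompactSupport f' := by rw [hder]; exact hc.deriv
  have hpc : Continuous (gaussianPDFReal 0 v) := by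
    rw [gaussianPDFReal_def]; fun_prop
  have hv' : (v : ℝ) ≠ 0 := by exact_mod_cast hv
  have hpd : ∀ s, HasDerivAt (gaussianPDFReal 0 v) (-(s / v) * gaussianPDFReal 0 v s) s := by
    intro s
    rw [gaussianPDFReal_def]
    have h1 : HasDerivAt (fun x : ℝ => -(x - 0) ^ 2 / (2 * (v : ℝ))) (-(s / v)) s := by
      have := ((((hasDerivAt_id s).sub_const 0).pow 2).neg).div_const (2 * (v : ℝ))
      refine this.congr_deriv ?_
      simp
      field_simp
    refine (h1.exp.const_mul ((√(2 * Real.pi * v))⁻¹)).congr_deriv ?_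
    ring
  rw [integral_gaussianReal_eq_integral_smul hv]
  have key := integral_mul_deriv_eq_deriv_mul_of_integrable
    (u := f) (u' := f') (v := gaussianPDFReal 0 v)
    (v' := fun s => -(s / v) * gaussianPDFReal 0 v s)
    (fun x _ => hf x) (fun x _ => hpd x)
    ((by fun_prop : Continuous _).integrable_of_hasCompactSupport hc.mul_right)
    ((by fun_prop : Continuous _).integrable_of_hasCompactSupport hc'.mul_right)
    ((by fun_prop : Continuous _).integrable_of_hasCompactSupport hc.mul_right)
  have e1 : ∀ s, gaussianPDFReal 0 v s • (s * f s - v * f' s)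
      = -(v : ℝ) * (f s * (-(s / v) * gaussianPDFReal 0 v s)) 
        - v * (f' s * gaussianPDFReal 0 v s) := by
    intro s; simp only [smul_eq_mul]; field_simp
  simp_rw [e1]
  rw [integral_sub, integral_const_mul, integral_const_mul, key]
  · ring
  · apply Integrable.const_mul
    exact ((by fun_prop : Continuous _).integrable_of_hasCompactSupport hc.mul_right)
  · apply Integrable.const_mul
    exact ((by fun_prop : Continuous _).integrable_of_hasCompactSupport hc'.mul_right)

set_option linter.unusedSectionVars false

section Aux

variable {H : Type*} [NormedAddCommGroup H] [InnerProductSpace ℝ H] [CompleteSpace H]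
    [SecondCountableTopology H] [MeasurableSpace H] [BorelSpace H]

lemma aux_gauss (V : H → NNReal) (γ : Measure H) [IsProbabilityMeasure γ]
    (hγ : ∀ x : H, Measure.map (fun u => ⟪u, x⟫) γ = gaussianReal 0 (V x)) : IsGaussian γ := by
  refine isGaussian_of_map_eq_gaussianReal fun L => 
    ⟨0, V ((InnerProductSpace.toDual ℝ H).symm L), ?_⟩
  rw [← hγ]
  congr 1
  ext u
  rw [real_inner_comm]; simp

lemma aux_indep (V : H → NNReal) (γ : Measure H) [IsProbabilityMeasure γ]
    (hγ : ∀ x : H, Measure.map (fun u => ⟪u, x⟫) γ = gaussianReal 0 (V x)) (e : H)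
    (he : ‖e‖ = 1)
    (hV : ∀ (t : ℝ) z, ⟪z, e⟫ = 0 → V (t • e + z) = V (t • e) + V z) :
    IndepFun (fun u : H => ⟪u, e⟫) (fun u : H => u - ⟪u, e⟫ • e) γ := by
  have hG := aux_gauss V γ hγ
  have hvar : ∀ x : H, Var[fun u => ⟪u, x⟫; γ] = V x := by
    intro x
    have := variance_map (X := id) (Y := fun u => ⟪u, x⟫) (μ := γ) (by fun_prop) (by fun_prop)
    rw [hγ] at this
    simp at this
    exact this.symm
  have hmem : ∀ x : H, MemLp (fun u => ⟪u, x⟫) 2 γ := by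
    intro x
    exact (IsGaussian.memLp_two_id (μ := γ)).inner_const x
  apply HasGaussianLaw.indepFun_of_covariance_inner
  · exact (IsGaussian.hasGaussianLaw_id (μ := γ)).map_fun
      ((innerSL ℝ e : H →L[ℝ] ℝ).prod (ContinuousLinearMap.id ℝ H - (innerSL ℝ e).smulRight e)) |>.congr 
        (by filter_upwards with u; simp [real_inner_comm])
  · intro x y
    set z := y - ⟪y, e⟫ • e with hz
    have hze : ⟪z, e⟫ = 0 := by
      simp [hz, inner_sub_left, inner_smul_left, he]
    have h1 : (fun u : H => ⟪x, ⟪u, e⟫⟫) = fun u => ⟪u, x • e⟫ := by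
      ext u; simp [inner_smul_right, mul_comm]
    have h2 : (fun u : H => ⟪y, u - ⟪u, e⟫ • e⟫) = fun u => ⟪u, z⟫ := by
      ext u; simp [hz, inner_sub_right, inner_smul_right, real_inner_comm, mul_comm]
    rw [h1, h2]
    have h3 := variance_fun_add (hmem (x • e)) (hmem z)
    simp_rw [← inner_add_right] at h3
    rw [hvar, hvar, hvar, hV x z hze] at h3
    push_cast at h3
    linarith

lemma aux_ibp (V : H → NNReal) (γ : Measure H) [IsProbabilityMeasure γ]
    (hγ : ∀ x : H, Measure.map (fun u => ⟪u, x⟫) γ = gaussianReal 0 (V x)) (e : H)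
    (he : ‖e‖ = 1)
    (hV : ∀ (t : ℝ) z, ⟪z, e⟫ = 0 → V (t • e + z) = V (t • e) + V z)
    (F F' : H → ℝ) (hF : Continuous F) (hF' : Continuous F')
    (hd : ∀ u (s : ℝ), HasDerivAt (fun s : ℝ => F (s • e + u)) (F' (s • e + u)) s)
    (hc : ∀ u, HasCompactSupport (fun s : ℝ => F (s • e + u)))
    (hi : Integrable (fun u => ⟪u, e⟫ * F u - V e * F' u) γ) :
    ∫ u, (⟪u, e⟫ * F u - V e * F' u) ∂γ = 0 := by
  have hind := aux_indep V γ hγ e he hV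
  rw [indepFun_iff_map_prod_eq_prod_map_map (by fun_prop) (by fun_prop), hγ] at hind
  set P : H → H := fun u => u - ⟪u, e⟫ • e with hP
  have hPm : Measurable P := by fun_prop
  have hid : ∀ u : H, ⟪u, e⟫ • e + P u = u := by intro u; simp [hP]
  have hPe : ∀ u : H, ⟪P u, e⟫ = 0 := by
    intro u; simp [hP, inner_sub_left, inner_smul_left, he]
  set Φ : H → ℝ := fun u => ⟪u, e⟫ * F u - V e * F' u with hΦ
  have hΦc : Continuous Φ := by fun_prop
  have hm : Measurable (fun u : H => (⟪u, e⟫, P u)) := by fun_prop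
  have hΨ : Continuous (fun p : ℝ × H => Φ (p.1 • e + p.2)) := by fun_prop
  have e1 : ∫ u, Φ u ∂γ = ∫ p, Φ (p.1 • e + p.2) ∂((gaussianReal 0 (V e)).prod (γ.map P)) := by
    rw [← hind, integral_map hm.aemeasurable hΨ.aestronglyMeasurable]
    simp_rw [hid]
  have hii : Integrable (fun p : ℝ × H => Φ (p.1 • e + p.2))
      ((gaussianReal 0 (V e)).prod (γ.map P)) := by
    rw [← hind, integrable_map_measure hΨ.aestronglyMeasurable hm.aemeasurable]
    simpa [Function.comp_def, hid] using hi
  have : IsProbabilityMeasure (γ.map P) := Measure.isProbabilityMeasure_map hPm.aemeasurable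
  rw [e1, integral_prod_symm _ hii, integral_map hPm.aemeasurable]
  · apply integral_eq_zero_of_ae
    filter_upwards with u
    have := aux_stein (V e) (fun s => F (s • e + P u)) (fun s => F' (s • e + P u))
      (hd (P u)) (by fun_prop) (hc (P u))
    simpa [hΦ, inner_add_left, inner_smul_left, he, hPe] using this
  · exact hii.integral_prod_right.aestronglyMeasurable

lemma aux_sq (γ : Measure H) [IsGaussian γ] : Integrable (fun u : H => (1 + ‖u‖) ^ 2) γ := by
  have h1 := (IsGaussian.memLp_two_id (μ := γ)).integrable_norm_pow (by norm_num)
  have h2 := (IsGaussian.integrable_id (μ := γ)).norm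
  have h3 := ((integrable_const (1 : ℝ)).add (h2.const_mul 2)).add h1
  refine h3.congr ?_
  filter_upwards with u
  simp
  ring

lemma aux_bd_s6 (γ : Measure H) [IsGaussian γ] (k : H → ℝ) (hk : Measurable k) (C : ℝ)
    (hC : ∀ u, |k u| ≤ C * (1 + ‖u‖) ^ 2) : Integrable k γ :=
  ((aux_sq γ).const_mul C).mono' hk.aestronglyMeasurable (by filter_upwards with u; exact hC u)

lemma aux_limit (V : H → NNReal) (γ : Measure H) [IsProbabilityMeasure γ]
    (hγ : ∀ x : H, Measure.map (fun u => ⟪u, x⟫) γ = gaussianReal 0 (V x)) (e : H)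
    (he : ‖e‖ = 1)
    (hV : ∀ (t : ℝ) z, ⟪z, e⟫ = 0 → V (t • e + z) = V (t • e) + V z)
    (h h' : H → ℝ) (hh : Continuous h) (hh' : Continuous h')
    (hd : ∀ u (s : ℝ), HasDerivAt (fun s : ℝ => h (s • e + u)) (h' (s • e + u)) s)
    (hc : ∀ u, HasCompactSupport (fun s : ℝ => h (s • e + u)))
    (C : ℝ) (hC : ∀ u, |h u| ≤ C) (hC' : ∀ u, |h' u| ≤ C) :
    ∫ u, (⟪u, e⟫ * (‖u‖ * h u) - V e * (⟪u, e⟫ / ‖u‖ * h u + ‖u‖ * h' u)) ∂γ = 0 := by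
  have hG := aux_gauss V γ hγ
  have hC0 : 0 ≤ C := (abs_nonneg _).trans (hC 0)
  let R : ℝ → H → ℝ := fun ε u => √(ε + ‖u‖ ^ 2)
  let T : ℝ → H → ℝ := fun ε u =>
    ⟪u, e⟫ * (R ε u * h u) - V e * (⟪u, e⟫ / R ε u * h u + R ε u * h' u)
  have hin : ∀ u : H, |⟪u, e⟫| ≤ ‖u‖ := by
    intro u
    simpa [he] using abs_real_inner_le_norm u e
  have hbound : ∀ ε : ℝ, 0 < ε → ε ≤ 1 → ∀ u, |T ε u| ≤ (C + 2 * V e * C) * (1 + ‖u‖) ^ 2 := by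
    intro ε h0 h1 u
    have hn := norm_nonneg u
    have hR : R ε u ≤ 1 + ‖u‖ := by
      apply Real.sqrt_le_iff.2
      constructor
      · positivity
      · nlinarith
    have hR0 : 0 < R ε u := Real.sqrt_pos.2 (by positivity)
    have hR1 : ‖u‖ ≤ R ε u := Real.le_sqrt_of_sq_le (by linarith)
    have a1 : |⟪u, e⟫ * (R ε u * h u)| ≤ (1 + ‖u‖) * ((1 + ‖u‖) * C) := by
      rw [abs_mul, abs_mul, abs_of_pos hR0]
      gcongr
      · linarith [hin u]
      · exact hC u
    have a2 : |⟪u, e⟫ / R ε u * h u| ≤ 1 * C := by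
      rw [abs_mul, abs_div, abs_of_pos hR0]
      gcongr
      · rw [div_le_one hR0]; exact (hin u).trans hR1
      · exact hC u
    have a3 : |R ε u * h' u| ≤ (1 + ‖u‖) * C := by
      rw [abs_mul, abs_of_pos hR0]
      gcongr
      exact hC' u
    have a4 : |V e * (⟪u, e⟫ / R ε u * h u + R ε u * h' u)| ≤ V e * (1 * C + (1 + ‖u‖) * C) := by
      rw [abs_mul, abs_of_nonneg (NNReal.coe_nonneg _)]
      gcongr
      exact (abs_add_le _ _).trans (add_le_add a2 a3)
    refine (abs_sub _ _).trans ((add_le_add a1 a4).trans ?_)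
    have : V e * (1 * C + (1 + ‖u‖) * C) ≤ V e * (2 * C * (1 + ‖u‖) ^ 2) := by
      gcongr
      nlinarith [mul_nonneg hC0 hn, mul_nonneg (mul_nonneg hC0 hn) hn]
    linarith
  have hRc : ∀ ε : ℝ, Continuous (R ε) := by intro ε; fun_prop
  have hRpos : ∀ ε : ℝ, 0 < ε → ∀ u, 0 < R ε u :=
    fun ε h0 u => Real.sqrt_pos.2 (by positivity)
  have hTm : ∀ ε : ℝ, Measurable (T ε) := by
    intro ε
    have := (hRc ε).measurable
    have := hh.measurable
    have := hh'.measurable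
    fun_prop
  have hzero : ∀ ε : ℝ, 0 < ε → ε ≤ 1 → ∫ u, T ε u ∂γ = 0 := by
    intro ε h0 h1
    have hRne : ∀ u, R ε u ≠ 0 := fun u => (hRpos ε h0 u).ne'
    refine aux_ibp V γ hγ e he hV (fun u => R ε u * h u)
      (fun u => ⟪u, e⟫ / R ε u * h u + R ε u * h' u) ((hRc ε).mul hh) ?_ ?_ ?_ ?_
    · have := hRc ε
      fun_prop (disch := assumption)
    · intro u s
      have d1 : HasDerivAt (fun s : ℝ => s • e + u) e s := by
        simpa using ((hasDerivAt_id s).smul_const e).add_const u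
      have d2 := (d1.norm_sq.const_add ε).sqrt (by positivity)
      refine (d2.mul (hd u s)).congr_deriv ?_
      simp only [R]
      have := hRne (s • e + u)
      simp only [R] at this
      field_simp
    · intro u
      exact (hc u).mul_left
    · exact aux_bd_s6 γ (T ε) (hTm ε) _ (hbound ε h0 h1)
  have hlim := tendsto_integral_of_dominated_convergence
    (F := fun (m : ℕ) => T (1 / ((m : ℝ) + 1)))
    (f := fun u => ⟪u, e⟫ * (‖u‖ * h u) - V e * (⟪u, e⟫ / ‖u‖ * h u + ‖u‖ * h' u)) (μ := γ)
    (fun u => (C + 2 * V e * C) * (1 + ‖u‖) ^ 2)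
    (fun m => (hTm _).aestronglyMeasurable) ((aux_sq γ).const_mul _)
    (fun m => by
      filter_upwards with u
      apply hbound _ (by positivity)
      rw [div_le_one (by positivity)]
      have : (0 : ℝ) ≤ m := by positivity
      linarith)
    (by
      filter_upwards with u
      have hR : Filter.Tendsto (fun m : ℕ => R (1 / ((m : ℝ) + 1)) u) Filter.atTop
          (nhds ‖u‖) := by
        have h1 := (tendsto_one_div_add_atTop_nhds_zero_nat (𝕜 := ℝ)).add_const (‖u‖ ^ 2)
        have h2 := h1.sqrt
        simpa using h2
      by_cases hu : u = 0
      · subst hu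
        simp only [T, inner_zero_left, zero_div, zero_mul, zero_add]
        exact ((hR.mul_const _).const_mul _).const_sub _
      · have hn : ‖u‖ ≠ 0 := norm_ne_zero_iff.2 hu
        exact ((hR.mul_const _).const_mul _).sub
          ((((tendsto_const_nhds.div hR hn).mul_const _).add (hR.mul_const _)).const_mul _))
  refine tendsto_nhds_unique hlim ?_
  have : ∀ m : ℕ, ∫ u, T (1 / ((m : ℝ) + 1)) u ∂γ = 0 := by
    intro m
    apply hzero _ (by positivity)
    rw [div_le_one (by positivity)]
    have : (0 : ℝ) ≤ m := by positivity
    linarith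
  simp only [this]
  exact tendsto_const_nhds

end Aux

/-- **Infinitesimal invariance of the measure `‖u‖⁻¹ γ(du)` (analytic core of
Theorem 2.1).** Let `γ` be the centered Gaussian measure on a real separable Hilbert
space `H` whose covariance operator diagonalizes in a Hilbert basis `(e n)` with
eigenvalues `α n ^ 2`, `∑ α n ^ 2 < ∞`, and assume `α 0 > 0`. For every cylindrical
test function `f(u) = g(u_0, …, u_{N-1})` with `g` smooth and compactly supported,
the three integrands below are `γ`-integrable and
`∫ [ ‖u‖ Σ αₙ² ∂ₙ²g − ‖u‖ Σ uₙ ∂ₙg + ‖u‖⁻¹ Σ αₙ² uₙ ∂ₙg ] dγ = 0`. -/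
theorem stmt6
    {H : Type*} [NormedAddCommGroup H] [InnerProductSpace ℝ H] [CompleteSpace H]
    [SecondCountableTopology H] [MeasurableSpace H] [BorelSpace H]
    (b : HilbertBasis ℕ ℝ H) (α : ℕ → ℝ) (hα : ∀ n, 0 ≤ α n)
    (hsum : Summable fun n => (α n) ^ 2)
    (γ : Measure H) [IsProbabilityMeasure γ]
    (hγ : ∀ x : H, Measure.map (fun u => ⟪u, x⟫) γ
      = ProbabilityTheory.gaussianReal 0
          (Real.toNNReal (∑' n, (α n) ^ 2 * ⟪x, b n⟫ ^ 2)))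
    (hα0 : 0 < α 0)
    (N : ℕ) (hN : 1 ≤ N) (g : (Fin N → ℝ) → ℝ)
    (hg : ContDiff ℝ (⊤ : ℕ∞) g) (hsupp : HasCompactSupport g) :
    Integrable (fun u : H => ‖u‖ * ∑ n : Fin N, (α (n : ℕ)) ^ 2 *
        fderiv ℝ (fun y => fderiv ℝ g y (Pi.single n 1))
          (fun i => ⟪u, b (i : ℕ)⟫) (Pi.single n 1)) γ ∧
    Integrable (fun u : H => ‖u‖ * ∑ n : Fin N, ⟪u, b (n : ℕ)⟫ *
        fderiv ℝ g (fun i => ⟪u, b (i : ℕ)⟫) (Pi.single n 1)) γ ∧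
    Integrable (fun u : H => ‖u‖⁻¹ * ∑ n : Fin N, (α (n : ℕ)) ^ 2 * ⟪u, b (n : ℕ)⟫ *
        fderiv ℝ g (fun i => ⟪u, b (i : ℕ)⟫) (Pi.single n 1)) γ ∧
    ∫ u : H,
        (‖u‖ * ∑ n : Fin N, (α (n : ℕ)) ^ 2 *
            fderiv ℝ (fun y => fderiv ℝ g y (Pi.single n 1))
              (fun i => ⟪u, b (i : ℕ)⟫) (Pi.single n 1)
          - ‖u‖ * ∑ n : Fin N, ⟪u, b (n : ℕ)⟫ *
              fderiv ℝ g (fun i => ⟪u, b (i : ℕ)⟫) (Pi.single n 1)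
          + ‖u‖⁻¹ * ∑ n : Fin N, (α (n : ℕ)) ^ 2 * ⟪u, b (n : ℕ)⟫ *
              fderiv ℝ g (fun i => ⟪u, b (i : ℕ)⟫) (Pi.single n 1)) ∂γ = 0 := by
  have hsm : ∀ x : H, Summable fun n => (α n) ^ 2 * ⟪x, b n⟫ ^ 2 := by
    intro x
    refine Summable.of_nonneg_of_le (fun n => by positivity) (fun n => ?_)
      (hsum.mul_right (‖x‖ ^ 2))
    have h1 : |⟪x, b n⟫| ≤ ‖x‖ := by
      simpa [b.orthonormal.1 n] using abs_real_inner_le_norm x (b n)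
    have h2 : ⟪x, b n⟫ ^ 2 ≤ ‖x‖ ^ 2 := sq_le_sq' (by linarith [abs_le.1 h1]) (abs_le.1 h1).2
    gcongr
  let V : H → NNReal := fun x => Real.toNNReal (∑' n, (α n) ^ 2 * ⟪x, b n⟫ ^ 2)
  have hb : ∀ m n : ℕ, ⟪b m, b n⟫ = if m = n then 1 else 0 :=
    fun m n => orthonormal_iff_ite.1 b.orthonormal m n
  have hVb : ∀ k, (V (b k) : ℝ) = (α k) ^ 2 := by
    intro k
    have : (∑' n, (α n) ^ 2 * ⟪b k, b n⟫ ^ 2) = (α k) ^ 2 := by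
      rw [tsum_eq_single k]
      · rw [hb]
        simp
      · intro n hn
        simp [hb, hn.symm]
    simp only [V, this]
    exact Real.coe_toNNReal _ (by positivity)
  have hV : ∀ (k : ℕ) (t : ℝ) z, ⟪z, b k⟫ = 0 → V (t • b k + z) = V (t • b k) + V z := by
    intro k t z hz
    simp only [V]
    rw [← Real.toNNReal_add (tsum_nonneg fun n => by positivity)
      (tsum_nonneg fun n => by positivity), ← (hsm _).tsum_add (hsm _)]
    congr 2
    ext n
    by_cases hn : k = n
    · subst hn
      simp [inner_add_left, hz]
    · simp [inner_add_left, inner_smul_left, hb, hn]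
  have hG := aux_gauss V γ hγ
  let π : H → (Fin N → ℝ) := fun u i => ⟪u, b (i : ℕ)⟫
  have hπ : Continuous π := by fun_prop
  let G : Fin N → (Fin N → ℝ) → ℝ := fun n y => fderiv ℝ g y (Pi.single n 1)
  let G' : Fin N → (Fin N → ℝ) → ℝ := fun n y => fderiv ℝ (G n) y (Pi.single n 1)
  have hGs : ∀ n, ContDiff ℝ (⊤ : ℕ∞) (G n) := fun n =>
    (hg.fderiv_right (m := (⊤ : ℕ∞)) (by norm_cast)).clm_apply contDiff_const
  have hGc : ∀ n, Continuous (G n) := fun n => (hGs n).continuous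
  have hG'c : ∀ n, Continuous (G' n) := fun n =>
    (((hGs n).fderiv_right (m := (⊤ : ℕ∞)) (by norm_cast)).clm_apply contDiff_const).continuous
  have hGk : ∀ n, HasCompactSupport (G n) := fun n => hsupp.fderiv_apply ℝ _
  have hG'k : ∀ n, HasCompactSupport (G' n) := fun n => (hGk n).fderiv_apply ℝ _
  have hCn : ∀ n, ∃ C, (∀ y, |G n y| ≤ C) ∧ (∀ y, |G' n y| ≤ C) := by
    intro n
    obtain ⟨C1, h1⟩ := (hGk n).exists_bound_of_continuous (hGc n)
    obtain ⟨C2, h2⟩ := (hG'k n).exists_bound_of_continuous (hG'c n)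
    exact ⟨max C1 C2, fun y => (h1 y).trans (le_max_left _ _),
      fun y => (h2 y).trans (le_max_right _ _)⟩
  choose C hC hC' using hCn
  have hC0 : ∀ n, 0 ≤ C n := fun n => (abs_nonneg _).trans (hC n 0)
  have hin : ∀ (n : ℕ) (u : H), |⟪u, b n⟫| ≤ ‖u‖ := by
    intro n u
    simpa [b.orthonormal.1 n] using abs_real_inner_le_norm u (b n)
  have hGm : ∀ n, Measurable (fun u => G n (π u)) := fun n => ((hGc n).comp hπ).measurable
  have hG'm : ∀ n, Measurable (fun u => G' n (π u)) := fun n => ((hG'c n).comp hπ).measurable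
  have i1 : ∀ n : Fin N, Integrable (fun u : H => ‖u‖ * ((α n) ^ 2 * G' n (π u))) γ := by
    intro n
    have := hG'm n
    refine aux_bd_s6 γ _ (by fun_prop) ((α n) ^ 2 * C n) fun u => ?_
    have hn := norm_nonneg u
    rw [abs_mul, abs_mul, abs_norm, abs_of_nonneg (sq_nonneg (α n))]
    calc ‖u‖ * ((α n) ^ 2 * |G' n (π u)|) ≤ (1 + ‖u‖) ^ 2 * ((α n) ^ 2 * C n) := by
          gcongr
          · nlinarith
          · exact hC' n _
      _ = _ := by ring
  have i2 : ∀ n : Fin N, Integrable (fun u : H => ‖u‖ * (⟪u, b n⟫ * G n (π u))) γ := by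
    intro n
    have := hGm n
    refine aux_bd_s6 γ _ (by fun_prop) (C n) fun u => ?_
    have hn := norm_nonneg u
    rw [abs_mul, abs_mul, abs_norm]
    calc ‖u‖ * (|⟪u, b n⟫| * |G n (π u)|) ≤ (1 + ‖u‖) * ((1 + ‖u‖) * C n) := by
          have := hC0 n
          gcongr
          · linarith
          · linarith [hin n u]
          · exact hC n _
      _ = _ := by ring
  have i3 : ∀ n : Fin N,
      Integrable (fun u : H => ‖u‖⁻¹ * ((α n) ^ 2 * ⟪u, b n⟫ * G n (π u))) γ := by
    intro n
    have := hGm n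
    refine aux_bd_s6 γ _ (by fun_prop) ((α n) ^ 2 * C n) fun u => ?_
    have hn := norm_nonneg u
    rw [abs_mul, abs_mul, abs_mul, abs_inv, abs_norm, abs_of_nonneg (sq_nonneg (α n))]
    have hq : ‖u‖⁻¹ * |⟪u, b n⟫| ≤ 1 := by
      rw [inv_mul_eq_div]
      exact div_le_one_of_le₀ (hin n u) hn
    calc ‖u‖⁻¹ * ((α n) ^ 2 * |⟪u, b n⟫| * |G n (π u)|)
        = (‖u‖⁻¹ * |⟪u, b n⟫|) * ((α n) ^ 2 * |G n (π u)|) := by ring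
      _ ≤ (1 + ‖u‖) ^ 2 * ((α n) ^ 2 * C n) := by
          gcongr
          · nlinarith
          · exact hC n _
      _ = _ := by ring
  have key : ∀ n : Fin N, ∫ u, (⟪u, b n⟫ * (‖u‖ * G n (π u))
      - V (b n) * (⟪u, b n⟫ / ‖u‖ * G n (π u) + ‖u‖ * G' n (π u))) ∂γ = 0 := by
    intro n
    have hπl : ∀ (s : ℝ) (u : H), π (s • b n + u) = s • Pi.single n (1 : ℝ) + π u := by
      intro s u
      ext i
      simp only [π, inner_add_left, inner_smul_left, hb, Pi.add_apply, Pi.smul_apply,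
        Pi.single_apply, Fin.ext_iff]
      simp [eq_comm]
    refine aux_limit V γ hγ (b n) (b.orthonormal.1 n) (hV n) (fun u => G n (π u))
      (fun u => G' n (π u)) ((hGc n).comp hπ) ((hG'c n).comp hπ) ?_ ?_ (C n)
      (fun u => hC n _) (fun u => hC' n _)
    · intro u s
      simp only [hπl]
      have d1 : HasDerivAt (fun s : ℝ => s • (Pi.single n (1 : ℝ) : Fin N → ℝ) + π u)
          (Pi.single n (1 : ℝ)) s := by
        simpa using ((hasDerivAt_id s).smul_const (Pi.single n (1 : ℝ) : Fin N → ℝ)).add_const (π u)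
      exact (((hGs n).differentiable (by simp)) _).hasFDerivAt.comp_hasDerivAt s d1
    · intro u
      simp only [hπl]
      have hcont : Continuous (fun y : Fin N → ℝ => y n - π u n) := by fun_prop
      refine HasCompactSupport.intro ((hGk n).isCompact.image hcont) fun s hs => ?_
      by_contra hne
      exact hs ⟨_, subset_tsupport _ hne, by simp⟩
  have s1 := integrable_finsetSum Finset.univ (fun n _ => i1 n)
  have s2 := integrable_finsetSum Finset.univ (fun n _ => i2 n)
  have s3 := integrable_finsetSum Finset.univ (fun n _ => i3 n)
  simp_rw [← Finset.mul_sum] at s1 s2 s3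
  refine ⟨s1, s2, s3, ?_⟩
  have e1 : ∀ u : H, (‖u‖ * ∑ n : Fin N, (α (n : ℕ)) ^ 2 * G' n (π u)
      - ‖u‖ * ∑ n : Fin N, ⟪u, b (n : ℕ)⟫ * G n (π u)
      + ‖u‖⁻¹ * ∑ n : Fin N, (α (n : ℕ)) ^ 2 * ⟪u, b (n : ℕ)⟫ * G n (π u))
      = ∑ n : Fin N, -(⟪u, b n⟫ * (‖u‖ * G n (π u))
      - V (b n) * (⟪u, b n⟫ / ‖u‖ * G n (π u) + ‖u‖ * G' n (π u))) := by
    intro u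
    rw [Finset.mul_sum, Finset.mul_sum, Finset.mul_sum, ← Finset.sum_sub_distrib,
      ← Finset.sum_add_distrib]
    refine Finset.sum_congr rfl fun n _ => ?_
    rw [hVb]
    ring
  refine (integral_congr_ae (Filter.Eventually.of_forall e1)).trans ?_
  rw [integral_finsetSum]
  · refine Finset.sum_eq_zero fun n _ => ?_
    rw [integral_neg, key n, neg_zero]
  · intro n _
    refine (((i1 n).sub (i2 n)).add (i3 n)).congr ?_
    filter_upwards with u
    simp only [Pi.add_apply, Pi.sub_apply]
    rw [hVb]
    ring
end
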